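/- arXiv:2001.10522 — 2 statements merged into one kernel-verified Lean document; each statement's English description precedes it below -/
import Mathlib

section
/- Fix a natural number n ≥ 1 and assume (H1'), (H2'), (H3') and (H4'). Then the multi-delay Nicholson-type system has at least one positive ω-periodic solution: there exist differentiable ω-periodic functions x₁, x₂ : ℝ → ℝ with x₁(t) > 0 and x₂(t) > 0 for all t ∈ ℝ, satisfying x₁'(t) = −δ₁₁(t)x₁(t)/(c₁₁(t)+x₁(t)) + δ₁₂(t)x₂(t)/(c₁₂(t)+x₂(t)) + Σ_{j=1}^{n} b₁ⱼ(t)f(x₁(t−τ₁ⱼ(t))) and x₂'(t) = −δ₂₂(t)x₂(t)/(c₂₂(t)+x₂(t)) + δ₂₁(t)x₁(t)/(c₂₁(t)+x₁(t)) + Σ_{j=1}^{n} b₂ⱼ(t)f(x₂(t−τ₂ⱼ(t))) for all t ∈ ℝ. -/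
open Real Set

/-- `x⁺ := max_{t ∈ [0,ω]} x t`. -/
noncomputable def supC (ω : ℝ) (x : ℝ → ℝ) : ℝ := sSup (x '' Icc 0 ω)

/-- `x⁻ := min_{t ∈ [0,ω]} x t`. -/
noncomputable def infC (ω : ℝ) (x : ℝ → ℝ) : ℝ := sInf (x '' Icc 0 ω)

/-- A continuous, ω-periodic, positive coefficient function. -/
def NiceCoef (ω : ℝ) (g : ℝ → ℝ) : Prop :=
  Continuous g ∧ Function.Periodic g ω ∧ ∀ t, 0 < g t

section Helpers
open Metric MeasureTheory

section Brouwer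
variable {E : Type*} [NormedAddCommGroup E] [InnerProductSpace ℝ E] [FiniteDimensional ℝ E]

/-- `det (1 + t A)` can be recovered from its values at small nodes. -/
lemma det_interp (k : ℕ) (hk : Module.finrank ℝ E = k) (ε : ℝ) (hε : 0 < ε) :
    ∃ (v w : ℕ → ℝ), (∀ i ∈ Finset.range (k+1), 0 < v i ∧ v i ≤ ε) ∧
      (∑ i ∈ Finset.range (k+1), w i = 1) ∧
      ∀ A : E →L[ℝ] E, (ContinuousLinearMap.id ℝ E + A).det =
        ∑ i ∈ Finset.range (k+1), (ContinuousLinearMap.id ℝ E + v i • A).det * w i := by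
  let v : ℕ → ℝ := fun i => ε / (i + 1)
  have hv : Set.InjOn v (Finset.range (k+1)) := by
    intro i _ j _ h
    have h1 : (0:ℝ) < i + 1 := by positivity
    have h2 : (0:ℝ) < j + 1 := by positivity
    simp only [v] at h
    rw [div_eq_div_iff h1.ne' h2.ne'] at h
    have := mul_left_cancel₀ hε.ne' h
    have h3 : (i:ℝ) = j := by linarith
    exact_mod_cast h3
  refine ⟨v, fun i => (Lagrange.basis (Finset.range (k+1)) v i).eval 1, ?_, ?_, ?_⟩
  · intro i _
    have h1 : (0:ℝ) < i + 1 := by positivity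
    refine ⟨by positivity, ?_⟩
    exact div_le_self hε.le (by linarith [(Nat.cast_nonneg i : (0:ℝ) ≤ i)])
  · rw [← Polynomial.eval_finsetSum, Lagrange.sum_basis hv (by simp)]
    simp
  · intro A
    let b := stdOrthonormalBasis ℝ E
    let M := LinearMap.toMatrix b.toBasis b.toBasis (A : E →ₗ[ℝ] E)
    let p : Polynomial ℝ := Matrix.det ((Polynomial.X : Polynomial ℝ) • M.map Polynomial.C
      + (1 : Matrix _ _ ℝ).map Polynomial.C)
    have hp : ∀ t : ℝ, (ContinuousLinearMap.id ℝ E + t • A).det = p.eval t := by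
      intro t
      have h1 : (ContinuousLinearMap.id ℝ E + t • A).det = Matrix.det (t • M + 1) := by
        rw [ContinuousLinearMap.det, ← LinearMap.det_toMatrix b.toBasis]
        congr 1
        simp only [ContinuousLinearMap.toLinearMap_add, ContinuousLinearMap.toLinearMap_smul,
          map_add, map_smul]
        rw [add_comm]
        congr 1
        exact LinearMap.toMatrix_id _
      rw [h1]
      simp only [p]
      rw [← Polynomial.coe_evalRingHom, RingHom.map_det]
      congr 1
      ext i j
      by_cases hij : i = j <;> simp [hij] <;> ring
    have hdeg : p.degree < (Finset.range (k+1)).card := by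
      have := Polynomial.natDegree_det_X_add_C_le M 1
      rw [Finset.card_range]
      refine lt_of_le_of_lt Polynomial.degree_le_natDegree ?_
      have h2 : p.natDegree ≤ k := this.trans (by rw [Fintype.card_fin, hk])
      exact_mod_cast Nat.lt_succ_of_le h2
    have h1 := hp 1
    rw [one_smul] at h1
    rw [h1]
    conv_lhs => rw [Lagrange.eq_interpolate hv hdeg]
    rw [Lagrange.interpolate_apply, Polynomial.eval_finsetSum]
    refine Finset.sum_congr rfl fun i _ => ?_
    rw [hp]
    simp

lemma det_pos_near : ∃ ε > 0, ∀ A : E →L[ℝ] E, ‖A‖ < ε →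
    0 < (ContinuousLinearMap.id ℝ E + A).det := by
  have hc : Continuous fun A : E →L[ℝ] E => (ContinuousLinearMap.id ℝ E + A).det :=
    ContinuousLinearMap.continuous_det.comp (by fun_prop)
  have h0 : (0:ℝ) < (ContinuousLinearMap.id ℝ E + (0 : E →L[ℝ] E)).det := by
    simp [ContinuousLinearMap.det]
  have := hc.continuousAt.eventually (lt_mem_nhds h0)
  obtain ⟨ε, hε, h⟩ := Metric.eventually_nhds_iff.1 this
  exact ⟨ε, hε, fun A hA => h (by simpa using hA)⟩

lemma no_retraction [MeasurableSpace E] [BorelSpace E] (r : E → E) (hr : ContDiff ℝ 1 r)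
    (h1 : ∀ x ∈ closedBall (0:E) 1, ‖r x‖ = 1) (h2 : ∀ x ∈ sphere (0:E) 1, r x = x) : False := by
  let g : E → E := fun x => r x - x
  have hg : ContDiff ℝ 1 g := hr.sub contDiff_id
  have hgc : Continuous (fderiv ℝ g) := hg.continuous_fderiv one_ne_zero
  obtain ⟨C, hC⟩ := (isCompact_closedBall (0:E) 1).exists_bound_of_continuousOn hgc.continuousOn
  obtain ⟨ε, hε, hdet⟩ := det_pos_near (E := E)
  let C' : NNReal := ⟨max C 0, le_max_right _ _⟩
  have hC0 : (0:ℝ) ≤ C' := C'.2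
  have hlip : LipschitzOnWith C' g (closedBall 0 1) := by
    refine (convex_closedBall (0:E) 1).lipschitzOnWith_of_nnnorm_fderiv_le
      (fun x _ => hg.differentiable one_ne_zero x) (fun x hx => ?_)
    exact (hC x hx).trans (le_max_left _ _)
  let t0 : ℝ := min (ε / (2 * (C' + 1))) (1 / (2 * (C' + 1)))
  have ht0 : 0 < t0 := by positivity
  have key : ∀ t, 0 < t → t ≤ t0 →
      IntegrableOn (fun x => (ContinuousLinearMap.id ℝ E + t • fderiv ℝ g x).det) (ball 0 1) volume ∧
      ∫ x in ball (0:E) 1, (ContinuousLinearMap.id ℝ E + t • fderiv ℝ g x).det =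
        (volume (ball (0:E) 1)).toReal := by
    intro t ht htt
    have htC : t * C' ≤ 1/2 := by
      have : t ≤ 1 / (2 * (C' + 1)) := htt.trans (min_le_right _ _)
      rw [le_div_iff₀ (by positivity)] at this
      nlinarith
    have htε : t * C' < ε := by
      have : t ≤ ε / (2 * (C' + 1)) := htt.trans (min_le_left _ _)
      rw [le_div_iff₀ (by positivity)] at this
      nlinarith
    have ht1 : t < 1 := by
      have : t ≤ 1 / (2 * (C' + 1)) := htt.trans (min_le_right _ _)
      rw [le_div_iff₀ (by positivity)] at this
      nlinarith
    let f : E → E := fun x => x + t • g x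
    have hfd : ∀ x, HasFDerivAt f (ContinuousLinearMap.id ℝ E + t • fderiv ℝ g x) x := fun x =>
      (hasFDerivAt_id x).add ((hg.differentiable one_ne_zero x).hasFDerivAt.const_smul t)
    have happ : ApproximatesLinearOn f ((ContinuousLinearEquiv.refl ℝ E : E ≃L[ℝ] E) : E →L[ℝ] E)
        (closedBall 0 1) (1/2) := by
      intro x hx y hy
      have e : f x - f y - (ContinuousLinearEquiv.refl ℝ E : E →L[ℝ] E) (x - y)
          = t • (g x - g y) := by
        simp [f, smul_sub]; abel
      rw [e, norm_smul, Real.norm_of_nonneg ht.le]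
      have := hlip.norm_sub_le hx hy
      calc t * ‖g x - g y‖ ≤ t * (C' * ‖x - y‖) := by gcongr
        _ = (t * C') * ‖x - y‖ := by ring
        _ ≤ (1/2) * ‖x - y‖ := by gcongr
        _ = _ := by simp
    have hc : Subsingleton E ∨ (1/2 : NNReal) < ‖((ContinuousLinearEquiv.refl ℝ E).symm : E →L[ℝ] E)‖₊⁻¹ := by
      rcases subsingleton_or_nontrivial E with h | h
      · exact Or.inl h
      · right
        have : ‖((ContinuousLinearEquiv.refl ℝ E).symm : E →L[ℝ] E)‖₊ = 1 := by
          simp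
        rw [this]
        rw [inv_one]
        exact NNReal.half_lt_self one_ne_zero
    have hinj : InjOn f (closedBall 0 1) := happ.injOn hc
    have hopen : IsOpen (f '' ball 0 1) :=
      (happ.mono_set ball_subset_closedBall).open_image
        (ContinuousLinearEquiv.refl ℝ E).toNonlinearRightInverse isOpen_ball hc
    have hfcont : Continuous f := continuous_iff_continuousAt.2 fun x => (hfd x).continuousAt
    have hsub : f '' ball 0 1 ⊆ ball 0 1 := by
      rintro _ ⟨x, hx, rfl⟩
      have hx' : ‖x‖ < 1 := by simpa using hx
      have e : f x = (1 - t) • x + t • r x := by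
        simp only [f, g, smul_sub, sub_smul, one_smul]; abel
      rw [mem_ball_zero_iff, e]
      calc ‖(1 - t) • x + t • r x‖ ≤ ‖(1-t) • x‖ + ‖t • r x‖ := norm_add_le _ _
        _ = (1 - t) * ‖x‖ + t * 1 := by
          rw [norm_smul, norm_smul, h1 x (ball_subset_closedBall hx), Real.norm_of_nonneg ht.le,
            Real.norm_of_nonneg (by linarith)]
        _ < 1 := by nlinarith
    have himg : f '' ball 0 1 = ball 0 1 := by
      refine subset_antisymm hsub ?_
      have hcl : IsClosed (f '' closedBall 0 1) :=
        ((isCompact_closedBall (0:E) 1).image hfcont).isClosed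
      have hpre : IsPreconnected (ball (0:E) 1) := (convex_ball _ _).isPreconnected
      refine hpre.subset_of_closure_inter_subset hopen ?_ ?_
      · refine ⟨f 0, hsub ⟨0, by simp, rfl⟩, ⟨0, by simp, rfl⟩⟩
      · rintro y ⟨hy, hyb⟩
        have hy2 : y ∈ f '' closedBall 0 1 :=
          hcl.closure_subset_iff.2 (image_mono ball_subset_closedBall) hy
        obtain ⟨x, hx, rfl⟩ := hy2
        refine ⟨x, ?_, rfl⟩
        by_contra hxb
        have hxs : x ∈ sphere (0:E) 1 := by
          simp at hx hxb ⊢; linarith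
        have : f x = x := by simp [f, g, h2 x hxs]
        rw [this] at hyb
        exact hxb hyb
    have hpos : ∀ x ∈ ball (0:E) 1, 0 < (ContinuousLinearMap.id ℝ E + t • fderiv ℝ g x).det := by
      intro x hx
      apply hdet
      rw [norm_smul, Real.norm_of_nonneg ht.le]
      refine lt_of_le_of_lt ?_ htε
      gcongr
      exact (hC x (ball_subset_closedBall hx)).trans (le_max_left _ _)
    have hcontdet : Continuous fun x => (ContinuousLinearMap.id ℝ E + t • fderiv ℝ g x).det :=
      ContinuousLinearMap.continuous_det.comp (by fun_prop)
    constructor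
    · exact (hcontdet.continuousOn.integrableOn_compact (isCompact_closedBall (0:E) 1)).mono_set
        ball_subset_closedBall
    · have := integral_image_eq_integral_abs_det_fderiv_smul volume (measurableSet_ball (x := (0:E)) (ε := 1))
        (fun x _ => (hfd x).hasFDerivWithinAt) (hinj.mono ball_subset_closedBall) (fun _ => (1:ℝ))
      rw [himg] at this
      simp only [integral_const, smul_eq_mul, mul_one] at this
      simp only [measureReal_restrict_apply_univ] at this
      rw [← Measure.real, this]
      refine setIntegral_congr_fun measurableSet_ball fun x hx => ?_
      rw [abs_of_pos (hpos x hx)]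
  obtain ⟨v, w, hv, hw, hdi⟩ := det_interp (E := E) _ rfl t0 ht0
  have hzero : ∀ x ∈ ball (0:E) 1, (ContinuousLinearMap.id ℝ E + fderiv ℝ g x).det = 0 := by
    intro x hx
    have e : ContinuousLinearMap.id ℝ E + fderiv ℝ g x = fderiv ℝ r x := by
      have := ((hr.differentiable one_ne_zero x).hasFDerivAt.sub (hasFDerivAt_id x)).fderiv
      have h : fderiv ℝ g x = fderiv ℝ r x - ContinuousLinearMap.id ℝ E := this
      rw [h]; abel
    rw [e]
    have hd := (hr.differentiable one_ne_zero x).hasFDerivAt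
    have hin : ∀ u, inner ℝ (r x) (fderiv ℝ r x u) = 0 := by
      intro u
      have h3 : HasFDerivAt (fun y => ‖r y‖^2) (0 : E →L[ℝ] ℝ) x := by
        refine (hasFDerivAt_const (1:ℝ) x).congr_of_eventuallyEq ?_
        filter_upwards [isOpen_ball.mem_nhds hx] with y hy
        simp [h1 y (ball_subset_closedBall hy)]
      have h4 := h3.unique hd.norm_sq
      have h5 := congrArg (fun L : E →L[ℝ] ℝ => L u) h4
      simp at h5
      exact h5
    by_contra hne
    have hu : IsUnit (LinearMap.det (fderiv ℝ r x : E →ₗ[ℝ] E)) := isUnit_iff_ne_zero.2 hne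
    have hs : Function.Surjective (fderiv ℝ r x : E →ₗ[ℝ] E) :=
      ((LinearMap.isUnit_iff_isUnit_det _).2 hu |> fun h => (Module.End.isUnit_iff _).1 h).2
    obtain ⟨u, hu⟩ := hs (r x)
    have h6 := hin u
    rw [show fderiv ℝ r x u = r x from hu, real_inner_self_eq_norm_sq, h1 x (ball_subset_closedBall hx)] at h6
    norm_num at h6
  have hI : ∫ x in ball (0:E) 1, (ContinuousLinearMap.id ℝ E + fderiv ℝ g x).det
      = (volume (ball (0:E) 1)).toReal := by
    rw [show (fun x => (ContinuousLinearMap.id ℝ E + fderiv ℝ g x).det) = fun x => _ from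
      funext fun x => hdi (fderiv ℝ g x)]
    rw [integral_finsetSum]
    · have : ∀ i ∈ Finset.range (Module.finrank ℝ E + 1),
        ∫ x in ball (0:E) 1, (ContinuousLinearMap.id ℝ E + v i • fderiv ℝ g x).det * w i
          = (volume (ball (0:E) 1)).toReal * w i := by
        intro i hi
        rw [integral_mul_const, (key (v i) (hv i hi).1 (hv i hi).2).2]
      rw [Finset.sum_congr rfl this, ← Finset.mul_sum, hw, mul_one]
    · intro i hi
      exact (key (v i) (hv i hi).1 (hv i hi).2).1.mul_const _
  rw [setIntegral_congr_fun measurableSet_ball hzero] at hI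
  simp at hI
  have hp := measure_ball_pos volume (0:E) one_pos
  have hf := measure_ball_lt_top (μ := (volume : Measure E)) (x := (0:E)) (r := 1)
  have := ENNReal.toReal_pos hp.ne' hf.ne
  rw [← hI] at this
  exact lt_irrefl _ this
end Brouwer
section Schauder
variable {E : Type*} [NormedAddCommGroup E] [InnerProductSpace ℝ E] [FiniteDimensional ℝ E]

lemma fixed_of_contDiff (F : E → E) (hF : ContDiff ℝ 1 F) (ρ : ℝ) (hρ : 0 < ρ) (hρ1 : ρ < 1)
    (hb : ∀ x, ‖F x‖ ≤ ρ) : ∃ x, F x = x := by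
  by_contra! hne
  borelize E
  let χ : ContDiffBump (0:E) := ⟨ρ, (1 + ρ) / 2, hρ, by linarith⟩
  let h : E → E := fun x => x - χ x • F x
  have hh : ContDiff ℝ 1 h := contDiff_id.sub (χ.contDiff.smul hF)
  have h0 : ∀ x, h x ≠ 0 := by
    intro x hx
    have e : x = χ x • F x := sub_eq_zero.1 hx
    have hn : ‖x‖ ≤ ρ := by
      calc ‖x‖ = ‖χ x • F x‖ := by rw [← e]
        _ = χ x * ‖F x‖ := by rw [norm_smul, Real.norm_of_nonneg χ.nonneg]
        _ ≤ 1 * ρ := by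
          gcongr
          · exact χ.le_one
          · exact hb x
        _ = ρ := one_mul _
    have h1 : χ x = 1 := χ.one_of_mem_closedBall (by simpa using hn)
    rw [h1, one_smul] at e
    exact hne x e.symm
  refine no_retraction (fun x => ‖h x‖⁻¹ • h x) ?_ ?_ ?_
  · exact ((hh.norm ℝ h0).inv (fun x => norm_ne_zero_iff.2 (h0 x))).smul hh
  · intro x _
    rw [norm_smul, norm_inv, norm_norm, inv_mul_cancel₀ (norm_ne_zero_iff.2 (h0 x))]
  · intro x hx
    have hx' : ‖x‖ = 1 := by simpa using hx
    have : χ x = 0 := χ.zero_of_le_dist (by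
      rw [dist_zero_right, hx']
      show (1 + ρ) / 2 ≤ 1
      linarith)
    simp [h, this, hx']

lemma approx_fixed (F : E → E) (hF : Continuous F) (M : ℝ) (hM : 0 ≤ M) (hb : ∀ x, ‖F x‖ ≤ M)
    (ε : ℝ) (hε : 0 < ε) : ∃ x, ‖F x - x‖ ≤ ε := by
  obtain ⟨G, hG, hGF, -⟩ := hF.exists_contDiff_approx 1 (ε := fun _ => ε) continuous_const
    (fun _ => hε)
  let S : ℝ := 2 * (M + ε)
  have hS : 0 < S := by positivity
  have hGb : ∀ x, ‖G x‖ ≤ M + ε := by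
    intro x
    have h1 := hGF x
    rw [dist_eq_norm] at h1
    have h2 := norm_le_norm_add_norm_sub' (G x) (F x)
    linarith [hb x]
  obtain ⟨x, hx⟩ := fixed_of_contDiff (fun x => S⁻¹ • G (S • x))
    (by
      have hG' : ContDiff ℝ 1 G := by exact_mod_cast hG
      exact (hG'.comp (contDiff_id.const_smul S)).const_smul S⁻¹) (1/2) (by norm_num) (by norm_num)
    (by
      intro x
      rw [norm_smul, norm_inv, Real.norm_of_nonneg hS.le, inv_mul_le_iff₀ hS]
      have := hGb (S • x)
      simp only [S] at *
      linarith)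
  refine ⟨S • x, ?_⟩
  have e : S • x = G (S • x) := by
    conv_lhs => rw [← hx]
    rw [smul_smul, mul_inv_cancel₀ hS.ne', one_smul]
  have h3 := hGF (S • x)
  rw [← e, dist_comm, dist_eq_norm] at h3
  exact h3.le

variable {X : Type*} [NormedAddCommGroup X] [NormedSpace ℝ X]

lemma schauder_approx (T : X → X) (hT : Continuous T) (K : Set X) (hK : IsCompact K)
    (hTK : ∀ x, T x ∈ K) (ε : ℝ) (hε : 0 < ε) : ∃ x, ‖T x - x‖ ≤ ε := by
  obtain ⟨t, -, htf, hcov⟩ := hK.finite_cover_balls (half_pos hε)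
  obtain ⟨k, p, -, hp⟩ := htf.fin_param
  let lam : Fin k → X → ℝ := fun i y => max 0 (ε/2 - ‖y - p i‖)
  have hlam0 : ∀ i y, 0 ≤ lam i y := fun i y => le_max_left _ _
  have hlamc : ∀ i, Continuous (lam i) := fun i => by fun_prop
  let S : X → ℝ := fun y => ∑ i, lam i y
  have hSc : Continuous S := continuous_finsetSum _ fun i _ => hlamc i
  have hSpos : ∀ y ∈ K, 0 < S y := by
    intro y hy
    obtain ⟨z, hz, hyz⟩ := mem_iUnion₂.1 (hcov hy)
    rw [← hp] at hz
    obtain ⟨i, rfl⟩ := hz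
    refine Finset.sum_pos' (fun i _ => hlam0 i y) ⟨i, Finset.mem_univ _, ?_⟩
    refine lt_max_of_lt_right ?_
    rw [mem_ball, dist_eq_norm] at hyz
    linarith
  let comb : EuclideanSpace ℝ (Fin k) → X := fun a => ∑ i, a i • p i
  have hcc : Continuous comb := by fun_prop
  let Φ : EuclideanSpace ℝ (Fin k) → EuclideanSpace ℝ (Fin k) :=
    fun a => WithLp.toLp 2 fun i => lam i (T (comb a)) / S (T (comb a))
  have hΦ : Continuous Φ := by
    refine (PiLp.continuous_toLp 2 _).comp (continuous_pi fun i => ?_)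
    exact ((hlamc i).comp (hT.comp hcc)).div (hSc.comp (hT.comp hcc))
      fun a => (hSpos _ (hTK _)).ne'
  have hΦ0 : ∀ a i, 0 ≤ Φ a i := fun a i => div_nonneg (hlam0 _ _) (hSpos _ (hTK _)).le
  have hΦ1 : ∀ a, ∑ i, Φ a i = 1 := by
    intro a
    show ∑ i, lam i (T (comb a)) / S (T (comb a)) = 1
    rw [← Finset.sum_div, div_self (hSpos _ (hTK _)).ne']
  have hΦb : ∀ a, ‖Φ a‖ ≤ 1 := by
    intro a
    rw [EuclideanSpace.norm_eq]
    refine Real.sqrt_le_iff.2 ⟨zero_le_one, ?_⟩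
    rw [one_pow]
    refine le_trans (Finset.sum_le_sum fun i _ => ?_) (hΦ1 a).le
    have : Φ a i ≤ 1 := by
      rw [← hΦ1 a]; exact Finset.single_le_sum (fun j _ => hΦ0 a j) (Finset.mem_univ i)
    rw [Real.norm_of_nonneg (hΦ0 a i)]
    nlinarith [hΦ0 a i]
  let P : ℝ := ∑ i, ‖p i‖
  have hP : 0 ≤ P := Finset.sum_nonneg fun i _ => norm_nonneg _
  obtain ⟨a, ha⟩ := approx_fixed Φ hΦ 1 zero_le_one hΦb (ε / (2 * (P + 1))) (by positivity)
  refine ⟨comb a, ?_⟩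
  have e1 : ‖T (comb a) - comb (Φ a)‖ ≤ ε / 2 := by
    have e : T (comb a) - comb (Φ a) = ∑ i, Φ a i • (T (comb a) - p i) := by
      simp only [smul_sub, Finset.sum_sub_distrib, ← Finset.sum_smul, hΦ1, one_smul, comb]
    rw [e]
    calc ‖∑ i, Φ a i • (T (comb a) - p i)‖ ≤ ∑ i, ‖Φ a i • (T (comb a) - p i)‖ := norm_sum_le _ _
      _ ≤ ∑ i, Φ a i * (ε/2) := by
        refine Finset.sum_le_sum fun i _ => ?_
        rw [norm_smul, Real.norm_of_nonneg (hΦ0 a i)]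
        by_cases h : ‖T (comb a) - p i‖ ≤ ε/2
        · exact mul_le_mul_of_nonneg_left h (hΦ0 a i)
        · have : Φ a i = 0 := by
            show lam i (T (comb a)) / S (T (comb a)) = 0
            have : lam i (T (comb a)) = 0 := max_eq_left (by linarith)
            rw [this, zero_div]
          rw [this]; simp
      _ = ε/2 := by rw [← Finset.sum_mul, hΦ1, one_mul]
  have e2 : ‖comb (Φ a) - comb a‖ ≤ ε / 2 := by
    have e : comb (Φ a) - comb a = ∑ i, (Φ a - a) i • p i := by
      simp only [comb, PiLp.sub_apply, sub_smul, Finset.sum_sub_distrib]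
    rw [e]
    calc ‖∑ i, (Φ a - a) i • p i‖ ≤ ∑ i, ‖(Φ a - a) i • p i‖ := norm_sum_le _ _
      _ ≤ ∑ i, (ε / (2 * (P + 1))) * ‖p i‖ := by
        refine Finset.sum_le_sum fun i _ => ?_
        rw [norm_smul]
        gcongr
        exact (PiLp.norm_apply_le _ i).trans ha
      _ = (ε / (2 * (P + 1))) * P := by rw [← Finset.mul_sum]
      _ ≤ ε / 2 := by
        rw [div_mul_eq_mul_div, div_le_div_iff₀ (by positivity) (by positivity)]
        nlinarith
  calc ‖T (comb a) - comb a‖ = ‖(T (comb a) - comb (Φ a)) + (comb (Φ a) - comb a)‖ := by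
        congr 1; abel
    _ ≤ _ := norm_add_le _ _
    _ ≤ ε := by linarith

/-- Schauder's fixed point theorem. -/
lemma schauder_fixed (T : X → X) (hT : Continuous T) (K : Set X) (hK : IsCompact K)
    (hTK : ∀ x, T x ∈ K) : ∃ x, T x = x := by
  choose x hx using fun n : ℕ => schauder_approx T hT K hK hTK (1 / ((n:ℝ) + 1)) (by positivity)
  obtain ⟨y, -, φ, hφ, hy⟩ := hK.tendsto_subseq (fun n => hTK (x n))
  have hd : Filter.Tendsto (fun n => T (x n) - x n) Filter.atTop (nhds 0) :=
    squeeze_zero_norm hx tendsto_one_div_add_atTop_nhds_zero_nat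
  have hx' : Filter.Tendsto (fun n => x (φ n)) Filter.atTop (nhds y) := by
    have := hy.sub (hd.comp hφ.tendsto_atTop)
    simpa using this
  exact ⟨y, tendsto_nhds_unique (hT.continuousAt.tendsto.comp hx') hy |>.trans rfl |> fun h => by
    simpa using h⟩
end Schauder
section Circle
variable {ω : ℝ}

/-- Periodic solution operator of `y' = -L y + g`. -/
noncomputable def perOp (ω L : ℝ) (g : AddCircle ω → ℝ) (θ : AddCircle ω) : ℝ :=
  (Real.exp (L * ω) - 1)⁻¹ * ∫ s in (0:ℝ)..ω, Real.exp (L * s) * g (θ + (s : AddCircle ω))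

lemma perOp_hasDerivAt (hω : 0 < ω) {L : ℝ} (hL : 0 < L) (g : AddCircle ω → ℝ)
    (hg : Continuous g) (t : ℝ) :
    HasDerivAt (fun t : ℝ => perOp ω L g (t : AddCircle ω))
      (-(L * perOp ω L g (t : AddCircle ω)) + g (t : AddCircle ω)) t := by
  have hD : 0 < Real.exp (L * ω) - 1 := by
    have := Real.add_one_lt_exp (x := L * ω) (by positivity)
    have h2 : 0 < L * ω := by positivity
    linarith
  let q : ℝ → ℝ := fun s => Real.exp (L * s) * g (s : AddCircle ω)
  have hcoe : Continuous (fun s : ℝ => (s : AddCircle ω)) := AddCircle.continuous_mk' ω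
  have hq : Continuous q := by
    have := hg.comp hcoe
    exact (by fun_prop : Continuous fun s : ℝ => Real.exp (L * s)).mul this
  let Q : ℝ → ℝ := fun t => ∫ s in (0:ℝ)..t, q s
  have hQ : ∀ t, HasDerivAt Q (q t) t := fun t => hq.integral_hasStrictDerivAt 0 t |>.hasDerivAt
  have e : ∀ t : ℝ, perOp ω L g (t : AddCircle ω) =
      (Real.exp (L * ω) - 1)⁻¹ * (Real.exp (-(L * t)) * (Q (t + ω) - Q t)) := by
    intro t
    unfold perOp
    congr 1
    have h1 : Q (t + ω) - Q t = ∫ s in t..(t+ω), q s :=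
      intervalIntegral.integral_interval_sub_left (hq.intervalIntegrable _ _)
        (hq.intervalIntegrable _ _)
    rw [h1]
    have h2 := intervalIntegral.integral_comp_add_left (a := 0) (b := ω) q t
    rw [add_zero] at h2
    rw [← h2, ← intervalIntegral.integral_const_mul]
    refine intervalIntegral.integral_congr fun s _ => ?_
    simp only [q]
    rw [← mul_assoc, ← Real.exp_add, AddCircle.coe_add]
    congr 2
    ring
  have hd : HasDerivAt (fun t : ℝ => (Real.exp (L * ω) - 1)⁻¹ *
      (Real.exp (-(L * t)) * (Q (t + ω) - Q t)))
      ((Real.exp (L * ω) - 1)⁻¹ * ((Real.exp (-(L * t)) * (-(L * 1))) * (Q (t + ω) - Q t)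
        + Real.exp (-(L * t)) * (q (t + ω) - q t))) t := by
    refine HasDerivAt.const_mul _ (HasDerivAt.mul ?_ (HasDerivAt.sub ?_ (hQ t)))
    · exact (((hasDerivAt_id t).const_mul L).neg).exp
    · exact (hQ (t + ω)).comp_add_const t ω
  rw [show (fun t : ℝ => perOp ω L g (t : AddCircle ω)) = _ from funext e, e t]
  convert hd using 1
  have hper : q (t + ω) = Real.exp (L * ω) * q t := by
    simp only [q]
    rw [AddCircle.coe_add, AddCircle.coe_period, add_zero, mul_add, Real.exp_add]
    ring
  have hqt : Real.exp (-(L * t)) * q t = g (t : AddCircle ω) := by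
    simp only [q]
    rw [← mul_assoc, ← Real.exp_add]
    simp
  rw [hper, ← hqt]
  field_simp

lemma perOp_bounds (hω : 0 < ω) {L m R : ℝ} (hL : 0 < L) (g : AddCircle ω → ℝ)
    (hg : Continuous g) (h : ∀ θ, L * m ≤ g θ ∧ g θ ≤ L * R) (θ : AddCircle ω) :
    m ≤ perOp ω L g θ ∧ perOp ω L g θ ≤ R := by
  have hD : 0 < Real.exp (L * ω) - 1 := by
    have := Real.add_one_lt_exp (x := L * ω) (by positivity)
    have h2 : 0 < L * ω := by positivity
    linarith
  have hcoe : Continuous (fun s : ℝ => (s : AddCircle ω)) := AddCircle.continuous_mk' ω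
  have hI : ∀ c : ℝ, ∫ s in (0:ℝ)..ω, Real.exp (L * s) * (L * c) = (Real.exp (L * ω) - 1) * c := by
    intro c
    have hder : ∀ s ∈ Set.uIcc 0 ω, HasDerivAt (fun s => Real.exp (L * s) * c)
        (Real.exp (L * s) * (L * c)) s := by
      intro s _
      have := (((hasDerivAt_id s).const_mul L).exp).mul_const c
      have e : Real.exp (L * s) * (L * c) = Real.exp (L * id s) * (L * 1) * c := by
        rw [id_eq, mul_one]; ring
      rw [e]
      exact this
    rw [intervalIntegral.integral_eq_sub_of_hasDerivAt hder
      (Continuous.intervalIntegrable (by fun_prop) _ _)]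
    simp; ring
  have hcont : Continuous fun s : ℝ => Real.exp (L * s) * g (θ + (s : AddCircle ω)) :=
    (by fun_prop : Continuous fun s : ℝ => Real.exp (L * s)).mul
      (hg.comp (continuous_const.add hcoe))
  unfold perOp
  constructor
  · rw [le_inv_mul_iff₀ hD, ← hI]
    refine intervalIntegral.integral_mono_on hω.le (Continuous.intervalIntegrable (by fun_prop) _ _)
      (hcont.intervalIntegrable _ _) fun s _ => ?_
    exact mul_le_mul_of_nonneg_left (h _).1 (Real.exp_pos _).le
  · rw [inv_mul_le_iff₀ hD, ← hI]
    refine intervalIntegral.integral_mono_on hω.le (hcont.intervalIntegrable _ _)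
      (Continuous.intervalIntegrable (by fun_prop) _ _) fun s _ => ?_
    exact mul_le_mul_of_nonneg_left (h _).2 (Real.exp_pos _).le

lemma compact_lip [Fact (0 < ω)] (m R C : ℝ) (hC : 0 ≤ C) :
    IsCompact {f : C(AddCircle ω, ℝ) | (∀ θ, f θ ∈ Icc m R) ∧
      ∀ s t : ℝ, |f (s : AddCircle ω) - f (t : AddCircle ω)| ≤ C * |s - t|} := by
  have hequi : ∀ (θ : AddCircle ω) (ε : ℝ), 0 < ε → ∃ U ∈ nhds θ, ∀ f : AddCircle ω → ℝ,
      (∀ s t : ℝ, |f (s : AddCircle ω) - f (t : AddCircle ω)| ≤ C * |s - t|) →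
      ∀ η ∈ U, |f θ - f η| < ε := by
    intro θ ε hε
    obtain ⟨t, rfl⟩ := QuotientAddGroup.mk_surjective θ
    refine ⟨(fun s : ℝ => (s : AddCircle ω)) '' ball t (ε / (C + 1)), ?_, ?_⟩
    · exact QuotientAddGroup.isOpenMap_coe.image_mem_nhds (ball_mem_nhds _ (by positivity))
    · rintro f hf _ ⟨s, hs, rfl⟩
      have h1 := hf t s
      rw [mem_ball, dist_comm, Real.dist_eq, lt_div_iff₀ (by positivity)] at hs
      refine lt_of_le_of_lt h1 ?_
      nlinarith [abs_nonneg (t - s)]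
  apply ArzelaAscoli.isCompact_of_equicontinuous
  · have hcpt : IsCompact (Set.pi univ fun _ : AddCircle ω => Icc m R) :=
      isCompact_univ_pi fun _ => isCompact_Icc
    refine hcpt.of_isClosed_subset ?_ ?_
    · have : (ContinuousMap.toFun '' {f : C(AddCircle ω, ℝ) | (∀ θ, f θ ∈ Icc m R) ∧
          ∀ s t : ℝ, |f (s : AddCircle ω) - f (t : AddCircle ω)| ≤ C * |s - t|}) =
          {f : AddCircle ω → ℝ | (∀ θ, f θ ∈ Icc m R) ∧
          ∀ s t : ℝ, |f (s : AddCircle ω) - f (t : AddCircle ω)| ≤ C * |s - t|} := by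
        ext f
        constructor
        · rintro ⟨f, hf, rfl⟩
          exact hf
        · intro hf
          refine ⟨⟨f, ?_⟩, hf, rfl⟩
          rw [continuous_iff_continuousAt]
          intro θ
          rw [Metric.continuousAt_iff']
          intro ε hε
          obtain ⟨U, hU, h⟩ := hequi θ ε hε
          filter_upwards [hU] with η hη
          rw [dist_comm, Real.dist_eq]
          exact h f hf.2 η hη
      rw [this]
      simp only [ofPred_and, ofPred_forall]
      refine IsClosed.inter ?_ ?_
      · exact isClosed_iInter fun θ => isClosed_Icc.preimage (continuous_apply θ)
      · refine isClosed_iInter fun s => isClosed_iInter fun t => isClosed_le ?_ continuous_const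
        exact ((continuous_apply (A := fun _ : AddCircle ω => ℝ) (s : AddCircle ω)).sub
          (continuous_apply (A := fun _ : AddCircle ω => ℝ) (t : AddCircle ω))).abs
    · rintro _ ⟨f, hf, rfl⟩ θ _
      exact hf.1 θ
  · intro θ
    rw [Metric.equicontinuousAt_iff_right]
    intro ε hε
    obtain ⟨U, hU, h⟩ := hequi θ ε hε
    filter_upwards [hU] with η hη f
    rw [Real.dist_eq]
    exact h f f.2.2 η hη

lemma periodic_exists [hω : Fact (0 < ω)] {L m R : ℝ} (hL : 0 < L)
    (G₁ G₂ : C(AddCircle ω, ℝ) × C(AddCircle ω, ℝ) → AddCircle ω → ℝ)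
    (hG₁ : Continuous (Function.uncurry G₁)) (hG₂ : Continuous (Function.uncurry G₂))
    (hb₁ : ∀ x θ, L * m ≤ G₁ x θ ∧ G₁ x θ ≤ L * R)
    (hb₂ : ∀ x θ, L * m ≤ G₂ x θ ∧ G₂ x θ ≤ L * R) :
    ∃ x : C(AddCircle ω, ℝ) × C(AddCircle ω, ℝ),
      (∀ θ, m ≤ x.1 θ ∧ x.1 θ ≤ R) ∧ (∀ θ, m ≤ x.2 θ ∧ x.2 θ ≤ R) ∧
      (∀ t : ℝ, HasDerivAt (fun t : ℝ => x.1 (t : AddCircle ω))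
        (-(L * x.1 (t : AddCircle ω)) + G₁ x (t : AddCircle ω)) t) ∧
      (∀ t : ℝ, HasDerivAt (fun t : ℝ => x.2 (t : AddCircle ω))
        (-(L * x.2 (t : AddCircle ω)) + G₂ x (t : AddCircle ω)) t) := by
  have hcoe : Continuous (fun s : ℝ => (s : AddCircle ω)) := AddCircle.continuous_mk' ω
  have hmR : m ≤ R := by
    have := hb₁ 0 0
    exact le_of_mul_le_mul_left (this.1.trans this.2) hL
  let C : ℝ := L * (R - m)
  have hC : 0 ≤ C := mul_nonneg hL.le (by linarith)
  -- the key construction for one component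
  have main : ∀ G : C(AddCircle ω, ℝ) × C(AddCircle ω, ℝ) → AddCircle ω → ℝ,
      Continuous (Function.uncurry G) → (∀ x θ, L * m ≤ G x θ ∧ G x θ ≤ L * R) →
      ∃ T : C(AddCircle ω, ℝ) × C(AddCircle ω, ℝ) → C(AddCircle ω, ℝ), Continuous T ∧
        (∀ x θ, T x θ = perOp ω L (G x) θ) ∧
        ∀ x, T x ∈ {f : C(AddCircle ω, ℝ) | (∀ θ, f θ ∈ Icc m R) ∧
          ∀ s t : ℝ, |f (s : AddCircle ω) - f (t : AddCircle ω)| ≤ C * |s - t|} := by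
    intro G hG hb
    have hGx : ∀ x, Continuous (G x) := fun x => hG.comp (by fun_prop : Continuous fun θ => (x, θ))
    have hjoint : Continuous (fun p : (C(AddCircle ω, ℝ) × C(AddCircle ω, ℝ)) × AddCircle ω =>
        perOp ω L (G p.1) p.2) := by
      unfold perOp
      refine continuous_const.mul ?_
      apply intervalIntegral.continuous_parametric_intervalIntegral_of_continuous'
      have h1 : Continuous fun q : ((C(AddCircle ω, ℝ) × C(AddCircle ω, ℝ)) × AddCircle ω) × ℝ =>
          Function.uncurry G (q.1.1, q.1.2 + (q.2 : AddCircle ω)) :=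
        hG.comp ((continuous_fst.comp continuous_fst).prodMk
          ((continuous_snd.comp continuous_fst).add (hcoe.comp continuous_snd)))
      exact (by fun_prop : Continuous fun q :
        ((C(AddCircle ω, ℝ) × C(AddCircle ω, ℝ)) × AddCircle ω) × ℝ => Real.exp (L * q.2)).mul h1
    let T : C(AddCircle ω, ℝ) × C(AddCircle ω, ℝ) → C(AddCircle ω, ℝ) := fun x =>
      ⟨fun θ => perOp ω L (G x) θ, hjoint.comp (by fun_prop : Continuous fun θ => (x, θ))⟩
    refine ⟨T, ContinuousMap.continuous_of_continuous_uncurry _ hjoint, fun _ _ => rfl, ?_⟩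
    intro x
    have hB := perOp_bounds hω.out hL (G x) (hGx x) (hb x)
    refine ⟨fun θ => hB θ, ?_⟩
    intro s t
    have hd := perOp_hasDerivAt hω.out hL (G x) (hGx x)
    have := Convex.norm_image_sub_le_of_norm_hasDerivWithin_le (s := univ) (C := C)
      (fun u _ => (hd u).hasDerivWithinAt) (fun u _ => ?_) convex_univ (mem_univ t) (mem_univ s)
    · exact this
    · have h1 := hB (u : AddCircle ω)
      have h2 := hb x (u : AddCircle ω)
      have h3 := mul_le_mul_of_nonneg_left h1.1 hL.le
      have h4 := mul_le_mul_of_nonneg_left h1.2 hL.le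
      rw [Real.norm_eq_abs, abs_le]
      simp only [C, mul_sub]
      constructor <;> linarith
  obtain ⟨T₁, hT₁, hT₁e, hT₁K⟩ := main G₁ hG₁ hb₁
  obtain ⟨T₂, hT₂, hT₂e, hT₂K⟩ := main G₂ hG₂ hb₂
  obtain ⟨x, hx⟩ := schauder_fixed (fun x => (T₁ x, T₂ x)) (hT₁.prodMk hT₂) _
    ((compact_lip (ω := ω) m R C hC).prod (compact_lip (ω := ω) m R C hC))
    (fun x => ⟨hT₁K x, hT₂K x⟩)
  have hx1 : T₁ x = x.1 := congrArg Prod.fst hx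
  have hx2 : T₂ x = x.2 := congrArg Prod.snd hx
  have e1 : ∀ θ, x.1 θ = perOp ω L (G₁ x) θ := fun θ => by rw [← hT₁e, hx1]
  have e2 : ∀ θ, x.2 θ = perOp ω L (G₂ x) θ := fun θ => by rw [← hT₂e, hx2]
  have hk1 := hT₁K x
  have hk2 := hT₂K x
  rw [hx1] at hk1
  rw [hx2] at hk2
  refine ⟨x, hk1.1, hk2.1, fun t => ?_, fun t => ?_⟩
  · simp only [e1]
    exact perOp_hasDerivAt hω.out hL (G₁ x)
      (hG₁.comp (by fun_prop : Continuous fun θ => (x, θ))) t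
  · simp only [e2]
    exact perOp_hasDerivAt hω.out hL (G₂ x)
      (hG₂.comp (by fun_prop : Continuous fun θ => (x, θ))) t
end Circle
end Helpers

section Numeric

lemma ricker_le (z : ℝ) : z * Real.exp (-z) ≤ 1 / Real.exp 1 := by
  have h := Real.add_one_le_exp (z - 1)
  rw [Real.exp_neg, ← div_eq_mul_inv, div_le_div_iff₀ (Real.exp_pos _) (Real.exp_pos _), one_mul]
  rw [Real.exp_sub, le_div_iff₀ (Real.exp_pos _)] at h
  linarith

lemma ricker_ge {m R z : ℝ} (hm : 0 < m) (hmR : m ≤ Real.exp (-R)) (h1 : m ≤ z) (h2 : z ≤ R) :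
    m * Real.exp (-m) ≤ z * Real.exp (-z) := by
  rcases le_total z 1 with hz | hz
  · have h := Real.add_one_le_exp (-(z - m))
    have e : Real.exp (-z) = Real.exp (-m) * Real.exp (-(z - m)) := by
      rw [← Real.exp_add]; congr 1; ring
    rw [e]
    have h3 : m ≤ z * Real.exp (-(z - m)) := by
      have : z * (-(z - m) + 1) ≤ z * Real.exp (-(z - m)) :=
        mul_le_mul_of_nonneg_left h (by linarith)
      nlinarith
    have := mul_le_mul_of_nonneg_left h3 (Real.exp_pos (-m)).le
    linarith
  · have h3 : Real.exp (-R) ≤ Real.exp (-z) := Real.exp_le_exp.2 (by linarith)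
    have h4 : Real.exp (-m) ≤ 1 := Real.exp_le_one_iff.2 (by linarith)
    have h5 := Real.exp_pos (-z)
    nlinarith

lemma frac_mono {c p q : ℝ} (hc : 0 < c) (hq : 0 ≤ q) (h : q ≤ p) : q / (c + q) ≤ p / (c + p) := by
  rw [div_le_div_iff₀ (by linarith) (by linarith)]
  nlinarith

lemma lin_mono {L d c p q : ℝ} (hc : 0 < c) (hq : 0 ≤ q) (hd : 0 ≤ d) (h : q ≤ p) (hL : d ≤ L * c) :
    L * q - d * q / (c + q) ≤ L * p - d * p / (c + p) := by
  have h1 : 0 < c + q := by linarith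
  have h2 : 0 < c + p := by linarith
  have e : d * p / (c + p) - d * q / (c + q) = d * c * (p - q) / ((c + p) * (c + q)) := by
    field_simp; ring
  have h3 : d * c * (p - q) / ((c + p) * (c + q)) ≤ L * (p - q) := by
    rw [div_le_iff₀ (by positivity)]
    have hL0 : 0 ≤ L := by
      by_contra hneg
      nlinarith
    have h4 : d * c ≤ L * ((c + p) * (c + q)) := by
      calc d * c ≤ L * c * c := by gcongr
        _ = L * (c * c) := by ring
        _ ≤ L * ((c + p) * (c + q)) := by
          gcongr <;> linarith
    nlinarith [sub_nonneg.2 h]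
  linarith

/-- Everything one needs to know about the constants. -/
structure GoodConst {n : ℕ} (L m R Dm Dp Em Ep Cm Cp Fm Fp : ℝ) (bm bp : Fin n → ℝ) : Prop where
  hm : 0 < m
  hmR : m ≤ R
  hexp : m ≤ Real.exp (-R)
  hL : 0 < L
  hLC : Dp ≤ L * Cm
  lower : Dp * m / (Cm + m) ≤ Em * m / (Fp + m) + ∑ j, bm j * (m * Real.exp (-m))
  upper : Ep + (∑ j, bp j) / Real.exp 1 ≤ Dm * R / (Cp + R)

lemma GoodConst.bounds {n : ℕ} {L m R Dm Dp Em Ep Cm Cp Fm Fp : ℝ} {bm bp : Fin n → ℝ}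
    (h : GoodConst L m R Dm Dp Em Ep Cm Cp Fm Fp bm bp)
    (hDm : 0 < Dm) (hEm : 0 < Em) (hCm : 0 < Cm) (hFm : 0 < Fm) (hbm : ∀ j, 0 < bm j)
    {d e c f p q : ℝ} {b z : Fin n → ℝ}
    (hd : Dm ≤ d ∧ d ≤ Dp) (he : Em ≤ e ∧ e ≤ Ep) (hc : Cm ≤ c ∧ c ≤ Cp) (hf : Fm ≤ f ∧ f ≤ Fp)
    (hb : ∀ j, bm j ≤ b j ∧ b j ≤ bp j) (hp : m ≤ p ∧ p ≤ R) (hq : m ≤ q ∧ q ≤ R)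
    (hz : ∀ j, m ≤ z j ∧ z j ≤ R) :
    L * m ≤ L * p - d * p / (c + p) + e * q / (f + q) + ∑ j, b j * (z j * Real.exp (-z j)) ∧
    L * p - d * p / (c + p) + e * q / (f + q) + ∑ j, b j * (z j * Real.exp (-z j)) ≤ L * R := by
  obtain ⟨hm, hmR, hexp, hL, hLC, hlo, hup⟩ := h
  have hc0 : 0 < c := by linarith
  have hf0 : 0 < f := by linarith
  have hd0 : 0 < d := by linarith
  have he0 : 0 < e := by linarith
  have hdL : d ≤ L * c := hd.2.trans (hLC.trans (mul_le_mul_of_nonneg_left hc.1 hL.le))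
  constructor
  · have h1 := lin_mono hc0 hm.le hd0.le hp.1 hdL
    have h2 : d * m / (c + m) ≤ Dp * m / (Cm + m) := by
      have : 0 ≤ Dp := by linarith
      gcongr
      · exact hd.2
      · exact hc.1
    have h3 : Em * m / (Fp + m) ≤ e * q / (f + q) := by
      calc Em * m / (Fp + m) ≤ e * m / (f + m) := by
            gcongr
            · exact he.1
            · exact hf.2
        _ = e * (m / (f + m)) := by ring
        _ ≤ e * (q / (f + q)) := mul_le_mul_of_nonneg_left (frac_mono hf0 hm.le hq.1) he0.le
        _ = _ := by ring
    have h4 : ∑ j, bm j * (m * Real.exp (-m)) ≤ ∑ j, b j * (z j * Real.exp (-z j)) := by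
      refine Finset.sum_le_sum fun j _ => ?_
      exact mul_le_mul (hb j).1 (ricker_ge hm hexp (hz j).1 (hz j).2) (by positivity)
        ((hbm j).le.trans (hb j).1)
    linarith
  · have h1 := lin_mono hc0 (by linarith : 0 ≤ p) hd0.le hp.2 hdL
    have hR : 0 < R := by linarith
    have h2 : Dm * R / (Cp + R) ≤ d * R / (c + R) := by
      gcongr
      · exact hd.1
      · exact hc.2
    have h3 : e * q / (f + q) ≤ Ep := by
      rw [div_le_iff₀ (by linarith)]
      nlinarith [mul_nonneg he0.le hf0.le]
    have h4 : ∑ j, b j * (z j * Real.exp (-z j)) ≤ (∑ j, bp j) / Real.exp 1 := by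
      rw [Finset.sum_div]
      refine Finset.sum_le_sum fun j _ => ?_
      rw [div_eq_mul_one_div]
      refine mul_le_mul (hb j).2 (ricker_le _) ?_ (((hbm j).le.trans (hb j).1).trans (hb j).2)
      have := (hz j).1
      have : 0 < z j := by linarith
      positivity
    linarith

open Filter Topology in
lemma ev_upper {S D C : ℝ} (h : S < D) (hC : 0 < C) : ∀ᶠ R in atTop, S ≤ D * R / (C + R) := by
  filter_upwards [eventually_ge_atTop (S * C / (D - S)), eventually_gt_atTop 0] with R h1 h2
  rw [div_le_iff₀ (by linarith)] at h1
  rw [le_div_iff₀ (by linarith)]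
  linarith

open Filter Topology in
lemma ev_lower {D C E F B : ℝ} (hC : 0 < C) (hF : 0 < F) (h : D / C - E / F < B) :
    ∀ᶠ m in 𝓝[>] (0:ℝ), D * m / (C + m) ≤ E * m / (F + m) + B * (m * Real.exp (-m)) := by
  have hc : ContinuousAt (fun m : ℝ => E / (F + m) + B * Real.exp (-m) - D / (C + m)) 0 := by
    refine ContinuousAt.sub (ContinuousAt.add ?_ (by fun_prop)) ?_
    · exact continuousAt_const.div (by fun_prop) (by simpa using hF.ne')
    · exact continuousAt_const.div (by fun_prop) (by simpa using hC.ne')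
  have h0 : 0 < (fun m : ℝ => E / (F + m) + B * Real.exp (-m) - D / (C + m)) 0 := by
    simp; linarith
  have := (hc.eventually (lt_mem_nhds h0)).filter_mono (nhdsWithin_le_nhds (s := Ioi 0))
  filter_upwards [this, self_mem_nhdsWithin] with m h1 h2
  have h2' : 0 < m := h2
  have e : E * m / (F + m) + B * (m * Real.exp (-m)) - D * m / (C + m)
     = m * (E / (F + m) + B * Real.exp (-m) - D / (C + m)) := by ring
  have := mul_pos h2' h1
  linarith

end Numeric

section Final
variable {ω : ℝ}

lemma NiceCoef.bounds {g : ℝ → ℝ} (hω : 0 < ω) (hg : NiceCoef ω g) :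
    (∀ t, infC ω g ≤ g t ∧ g t ≤ supC ω g) ∧ 0 < infC ω g := by
  have hcpt : IsCompact (g '' Icc 0 ω) := isCompact_Icc.image hg.1
  have hne : (g '' Icc 0 ω).Nonempty := ⟨g 0, 0, ⟨le_rfl, hω.le⟩, rfl⟩
  constructor
  · intro t
    obtain ⟨s, hs, e⟩ := hg.2.1.exists_mem_Ico₀ hω t
    rw [e]
    have : g s ∈ g '' Icc 0 ω := ⟨s, ⟨hs.1, hs.2.le⟩, rfl⟩
    exact ⟨csInf_le hcpt.bddBelow this, le_csSup hcpt.bddAbove this⟩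
  · obtain ⟨s, _, e⟩ := hcpt.sInf_mem hne
    rw [infC, ← e]
    exact hg.2.2 s

lemma NiceCoef.exists_lift {g : ℝ → ℝ} (hg : NiceCoef ω g) :
    ∃ g' : AddCircle ω → ℝ, Continuous g' ∧ ∀ t : ℝ, g' (t : AddCircle ω) = g t := by
  refine ⟨hg.2.1.lift, ?_, fun t => rfl⟩
  exact (isQuotientMap_quotient_mk'.continuous_iff).2 hg.1

lemma exists_G [hω : Fact (0 < ω)] {n : ℕ} {d e c f : ℝ → ℝ} {b τ : Fin n → ℝ → ℝ}
    (hd : NiceCoef ω d) (he : NiceCoef ω e) (hc : NiceCoef ω c) (hf : NiceCoef ω f)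
    (hb : ∀ j, NiceCoef ω (b j)) (hτ : ∀ j, NiceCoef ω (τ j)) {L m R : ℝ}
    (h : GoodConst L m R (infC ω d) (supC ω d) (infC ω e) (supC ω e) (infC ω c) (supC ω c)
      (infC ω f) (supC ω f) (fun j => infC ω (b j)) (fun j => supC ω (b j)))
    (u v : C(AddCircle ω, ℝ) × C(AddCircle ω, ℝ) → C(AddCircle ω, ℝ))
    (hu : Continuous u) (hv : Continuous v) :
    ∃ G : C(AddCircle ω, ℝ) × C(AddCircle ω, ℝ) → AddCircle ω → ℝ,
      Continuous (Function.uncurry G) ∧ (∀ x θ, L * m ≤ G x θ ∧ G x θ ≤ L * R) ∧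
      ∀ x, (∀ θ, m ≤ u x θ ∧ u x θ ≤ R) → (∀ θ, m ≤ v x θ ∧ v x θ ≤ R) → ∀ t : ℝ,
        G x (t : AddCircle ω) = L * u x (t : AddCircle ω)
          - d t * u x (t : AddCircle ω) / (c t + u x (t : AddCircle ω))
          + e t * v x (t : AddCircle ω) / (f t + v x (t : AddCircle ω))
          + ∑ j, b j t * (u x ((t - τ j t : ℝ) : AddCircle ω) *
            Real.exp (-(u x ((t - τ j t : ℝ) : AddCircle ω)))) := by
  obtain ⟨d', hd'c, hd'⟩ := hd.exists_lift
  obtain ⟨e', he'c, he'⟩ := he.exists_lift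
  obtain ⟨c', hc'c, hc'⟩ := hc.exists_lift
  obtain ⟨f', hf'c, hf'⟩ := hf.exists_lift
  choose b' hb'c hb' using fun j => (hb j).exists_lift
  choose τ' hτ'c hτ' using fun j => (hτ j).exists_lift
  have hcoe : Continuous (fun s : ℝ => (s : AddCircle ω)) := AddCircle.continuous_mk' ω
  have hm := h.hm
  let cl : ℝ → ℝ := fun x => max m (min x R)
  have hclc : Continuous cl := by fun_prop
  have hcl : ∀ x, m ≤ cl x ∧ cl x ≤ R := fun x =>
    ⟨le_max_left _ _, max_le h.hmR (min_le_right _ _)⟩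
  have hcl2 : ∀ x, m ≤ x ∧ x ≤ R → cl x = x := fun x hx => by
    simp only [cl]; rw [min_eq_left hx.2, max_eq_right hx.1]
  have hcpos : ∀ θ, 0 < c' θ := fun θ => by
    obtain ⟨t, rfl⟩ := QuotientAddGroup.mk_surjective θ
    exact (hc' t).symm ▸ hc.2.2 t
  have hfpos : ∀ θ, 0 < f' θ := fun θ => by
    obtain ⟨t, rfl⟩ := QuotientAddGroup.mk_surjective θ
    exact (hf' t).symm ▸ hf.2.2 t
  refine ⟨fun x θ => L * cl (u x θ) - d' θ * cl (u x θ) / (c' θ + cl (u x θ))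
    + e' θ * cl (v x θ) / (f' θ + cl (v x θ))
    + ∑ j, b' j θ * (cl (u x (θ - (τ' j θ : AddCircle ω))) *
      Real.exp (-(cl (u x (θ - (τ' j θ : AddCircle ω)))))), ?_, ?_, ?_⟩
  · have h2 : Continuous fun p : (C(AddCircle ω, ℝ) × C(AddCircle ω, ℝ)) × AddCircle ω => p.2 :=
      continuous_snd
    have hU : Continuous fun p : (C(AddCircle ω, ℝ) × C(AddCircle ω, ℝ)) × AddCircle ω =>
        cl (u p.1 p.2) :=
      hclc.comp (ContinuousEval.continuous_eval.comp ((hu.comp continuous_fst).prodMk h2))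
    have hV : Continuous fun p : (C(AddCircle ω, ℝ) × C(AddCircle ω, ℝ)) × AddCircle ω =>
        cl (v p.1 p.2) :=
      hclc.comp (ContinuousEval.continuous_eval.comp ((hv.comp continuous_fst).prodMk h2))
    have hW : ∀ j, Continuous fun p : (C(AddCircle ω, ℝ) × C(AddCircle ω, ℝ)) × AddCircle ω =>
        cl (u p.1 (p.2 - (τ' j p.2 : AddCircle ω))) := fun j =>
      hclc.comp (ContinuousEval.continuous_eval.comp ((hu.comp continuous_fst).prodMk
        (h2.sub (hcoe.comp ((hτ'c j).comp h2)))))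
    refine Continuous.add (Continuous.add (Continuous.sub (continuous_const.mul hU) ?_) ?_) ?_
    · exact ((hd'c.comp h2).mul hU).div ((hc'c.comp h2).add hU) fun p =>
        (add_pos (hcpos _) (hm.trans_le (hcl _).1)).ne'
    · exact ((he'c.comp h2).mul hV).div ((hf'c.comp h2).add hV) fun p =>
        (add_pos (hfpos _) (hm.trans_le (hcl _).1)).ne'
    · exact continuous_finsetSum _ fun j _ => ((hb'c j).comp h2).mul
        ((hW j).mul (Real.continuous_exp.comp (hW j).neg))
  · intro x θ
    obtain ⟨t, rfl⟩ := QuotientAddGroup.mk_surjective θ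
    have hdb := hd.bounds hω.out
    have heb := he.bounds hω.out
    have hcb := hc.bounds hω.out
    have hfb := hf.bounds hω.out
    have hbb := fun j => (hb j).bounds hω.out
    refine h.bounds hdb.2 heb.2 hcb.2 hfb.2 (fun j => (hbb j).2) ?_ ?_ ?_ ?_ ?_ (hcl _) (hcl _)
      (fun j => hcl _)
    · exact (hd' t).symm ▸ hdb.1 t
    · exact (he' t).symm ▸ heb.1 t
    · exact (hc' t).symm ▸ hcb.1 t
    · exact (hf' t).symm ▸ hfb.1 t
    · exact fun j => (hb' j t).symm ▸ (hbb j).1 t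
  · intro x hux hvx t
    have hcu : ∀ θ, cl (u x θ) = u x θ := fun θ => hcl2 _ (hux θ)
    have hcv : ∀ θ, cl (v x θ) = v x θ := fun θ => hcl2 _ (hvx θ)
    simp only [hcu, hcv, hd', he', hc', hf', hb', hτ', AddCircle.coe_sub]
end Final

/-- Existence of a positive ω-periodic solution of the multi-delay
Nicholson-type system of Chen and Wang, under (H1')–(H4'). -/
theorem nicholson_multidelay_periodic_solution
    (ω : ℝ) (hω : 0 < ω)
    (n : ℕ) (hn : 1 ≤ n)
    (δ₁₁ δ₁₂ δ₂₁ δ₂₂ c₁₁ c₁₂ c₂₁ c₂₂ : ℝ → ℝ)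
    (b₁ b₂ τ₁ τ₂ : Fin n → ℝ → ℝ)
    (hδ₁₁ : NiceCoef ω δ₁₁) (hδ₁₂ : NiceCoef ω δ₁₂)
    (hδ₂₁ : NiceCoef ω δ₂₁) (hδ₂₂ : NiceCoef ω δ₂₂)
    (hc₁₁ : NiceCoef ω c₁₁) (hc₁₂ : NiceCoef ω c₁₂)
    (hc₂₁ : NiceCoef ω c₂₁) (hc₂₂ : NiceCoef ω c₂₂)
    (hb₁ : ∀ j, NiceCoef ω (b₁ j)) (hb₂ : ∀ j, NiceCoef ω (b₂ j))
    (hτ₁ : ∀ j, NiceCoef ω (τ₁ j)) (hτ₂ : ∀ j, NiceCoef ω (τ₂ j))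
    (H1' : (∑ j, supC ω (b₁ j)) / Real.exp 1 + supC ω δ₁₂ < infC ω δ₁₁)
    (H2' : (∑ j, supC ω (b₂ j)) / Real.exp 1 + supC ω δ₂₁ < infC ω δ₂₂)
    (H3' : supC ω δ₁₁ / infC ω c₁₁ - infC ω δ₁₂ / supC ω c₁₂ < ∑ j, infC ω (b₁ j))
    (H4' : supC ω δ₂₂ / infC ω c₂₂ - infC ω δ₂₁ / supC ω c₂₁ < ∑ j, infC ω (b₂ j)) :
    ∃ x₁ x₂ : ℝ → ℝ,
      Differentiable ℝ x₁ ∧ Differentiable ℝ x₂ ∧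
      Function.Periodic x₁ ω ∧ Function.Periodic x₂ ω ∧
      (∀ t, 0 < x₁ t) ∧ (∀ t, 0 < x₂ t) ∧
      (∀ t, deriv x₁ t =
        -(δ₁₁ t * x₁ t / (c₁₁ t + x₁ t))
          + δ₁₂ t * x₂ t / (c₁₂ t + x₂ t)
          + ∑ j, b₁ j t * (x₁ (t - τ₁ j t) * Real.exp (-(x₁ (t - τ₁ j t))))) ∧
      (∀ t, deriv x₂ t =
        -(δ₂₂ t * x₂ t / (c₂₂ t + x₂ t))
          + δ₂₁ t * x₁ t / (c₂₁ t + x₁ t)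
          + ∑ j, b₂ j t * (x₂ (t - τ₂ j t) * Real.exp (-(x₂ (t - τ₂ j t))))) := by
  have : Fact (0 < ω) := ⟨hω⟩
  have sup_pos : ∀ {g : ℝ → ℝ}, NiceCoef ω g → 0 < supC ω g := fun hg =>
    (hg.2.2 0).trans_le ((hg.bounds hω).1 0).2
  have inf_pos : ∀ {g : ℝ → ℝ}, NiceCoef ω g → 0 < infC ω g := fun hg => (hg.bounds hω).2
  obtain ⟨R, hR1, hR2, hR0⟩ := ((ev_upper H1' (sup_pos hc₁₁)).and
    ((ev_upper H2' (sup_pos hc₂₂)).and (Filter.eventually_ge_atTop (1:ℝ)))).exists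
  have hsmall : ∀ᶠ m in nhdsWithin (0:ℝ) (Ioi 0), m < Real.exp (-R) :=
    (gt_mem_nhds (Real.exp_pos (-R))).filter_mono nhdsWithin_le_nhds
  obtain ⟨m, hm1, hm2, hm3, hm0⟩ := ((ev_lower (inf_pos hc₁₁) (sup_pos hc₁₂) H3').and
    ((ev_lower (inf_pos hc₂₂) (sup_pos hc₂₁) H4').and (hsmall.and self_mem_nhdsWithin))).exists
  have hm0' : 0 < m := hm0
  have hmR : m ≤ R := by
    have : Real.exp (-R) ≤ 1 := Real.exp_le_one_iff.2 (by linarith)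
    linarith
  let L : ℝ := supC ω δ₁₁ / infC ω c₁₁ + supC ω δ₂₂ / infC ω c₂₂
  have p1 := div_pos (sup_pos hδ₁₁) (inf_pos hc₁₁)
  have p2 := div_pos (sup_pos hδ₂₂) (inf_pos hc₂₂)
  have hL : 0 < L := add_pos p1 p2
  have g1 : GoodConst L m R (infC ω δ₁₁) (supC ω δ₁₁) (infC ω δ₁₂) (supC ω δ₁₂) (infC ω c₁₁)
      (supC ω c₁₁) (infC ω c₁₂) (supC ω c₁₂) (fun j => infC ω (b₁ j)) (fun j => supC ω (b₁ j)) :=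
    { hm := hm0', hmR := hmR, hexp := hm3.le, hL := hL
      hLC := (div_le_iff₀ (inf_pos hc₁₁)).1 (by simp only [L]; linarith)
      lower := by rw [← Finset.sum_mul]; exact hm1
      upper := by rw [add_comm]; exact hR1 }
  have g2 : GoodConst L m R (infC ω δ₂₂) (supC ω δ₂₂) (infC ω δ₂₁) (supC ω δ₂₁) (infC ω c₂₂)
      (supC ω c₂₂) (infC ω c₂₁) (supC ω c₂₁) (fun j => infC ω (b₂ j)) (fun j => supC ω (b₂ j)) :=
    { hm := hm0', hmR := hmR, hexp := hm3.le, hL := hL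
      hLC := (div_le_iff₀ (inf_pos hc₂₂)).1 (by simp only [L]; linarith)
      lower := by rw [← Finset.sum_mul]; exact hm2
      upper := by rw [add_comm]; exact hR2 }
  obtain ⟨G₁, hG₁c, hG₁b, hG₁⟩ := exists_G hδ₁₁ hδ₁₂ hc₁₁ hc₁₂ hb₁ hτ₁ g1 Prod.fst Prod.snd
    continuous_fst continuous_snd
  obtain ⟨G₂, hG₂c, hG₂b, hG₂⟩ := exists_G hδ₂₂ hδ₂₁ hc₂₂ hc₂₁ hb₂ hτ₂ g2 Prod.snd Prod.fst
    continuous_snd continuous_fst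
  obtain ⟨x, hx1, hx2, hd1, hd2⟩ := periodic_exists hL G₁ G₂ hG₁c hG₂c hG₁b hG₂b
  have hper : ∀ t : ℝ, ((t + ω : ℝ) : AddCircle ω) = (t : AddCircle ω) := fun t => by
    rw [AddCircle.coe_add, AddCircle.coe_period, add_zero]
  refine ⟨fun t => x.1 (t : AddCircle ω), fun t => x.2 (t : AddCircle ω),
    fun t => (hd1 t).differentiableAt, fun t => (hd2 t).differentiableAt,
    fun t => by simp only [hper], fun t => by simp only [hper],
    fun t => hm0'.trans_le (hx1 _).1, fun t => hm0'.trans_le (hx2 _).1, fun t => ?_, fun t => ?_⟩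
  · rw [(hd1 t).deriv, hG₁ x hx1 hx2 t]
    ring
  · rw [(hd2 t).deriv, hG₂ x hx2 hx1 t]
    ring
end

section
/- There exist differentiable 2π-periodic functions x₁, x₂ : ℝ → ℝ with x₁(t) > 0 and x₂(t) > 0 for all t ∈ ℝ satisfying, for all t ∈ ℝ, x₁'(t) = −(5 + 0.25 sin t)x₁(t)/(4 + x₁(t)) + 2(1 + 0.5 cos t)x₁(t−7)e^{−x₁(t−7)} + (2 + 0.25 cos t)x₂(t)/(2 + x₂(t)) and x₂'(t) = −(4 + 0.5 cos t)x₂(t)/(4 + x₂(t)) + 3(1 + 0.25 cos t)x₂(t−7)e^{−x₂(t−7)} + (2 + 0.5 sin t)x₁(t)/(3 + x₁(t)). -/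
open Set Metric MeasureTheory Filter Topology

theorem det_interp_s15 {E : Type*} [NormedAddCommGroup E] [NormedSpace ℝ E] [FiniteDimensional ℝ E]
    (v : Fin (Module.finrank ℝ E + 1) → ℝ) (hv : Function.Injective v) (A : E →L[ℝ] E) :
    (1 + A).det = ∑ k, (1 + v k • A).det * (Lagrange.basis Finset.univ v k).eval 1 := by
  classical
  let b := Module.finBasis ℝ E
  let M := LinearMap.toMatrix b b (A : E →ₗ[ℝ] E)
  let p : Polynomial ℝ := ((Polynomial.X : Polynomial ℝ) • M.map Polynomial.C
    + (1 : Matrix _ _ ℝ).map Polynomial.C).det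
  have hp : ∀ t : ℝ, (1 + t • A).det = p.eval t := by
    intro t
    have : ((1 + t • A : E →L[ℝ] E)).det = (1 + t • M).det := by
      rw [ContinuousLinearMap.det, ← LinearMap.det_toMatrix b]
      congr 1
      simp [M, LinearMap.toMatrix_one]
    rw [this]
    simp only [p]
    rw [← Polynomial.coe_evalRingHom, RingHom.map_det]
    congr 1
    ext i j
    by_cases h : i = j <;> simp [h, add_comm] <;> ring
  have hdeg : p.degree < (Finset.univ : Finset (Fin (Module.finrank ℝ E + 1))).card := by
    have h1 : p.natDegree ≤ _ := Polynomial.natDegree_det_X_add_C_le M 1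
    simp only [Fintype.card_fin] at h1
    refine lt_of_le_of_lt Polynomial.degree_le_natDegree ?_
    simp only [Finset.card_univ, Fintype.card_fin]
    exact_mod_cast Nat.lt_succ_of_le h1
  have h := Lagrange.eq_interpolate (s := Finset.univ) (v := v) hv.injOn hdeg
  have h1 : (1 + A).det = p.eval 1 := by rw [← hp]; simp
  rw [h1]
  conv_lhs => rw [h]
  rw [Lagrange.interpolate_apply, Polynomial.eval_finsetSum]
  refine Finset.sum_congr rfl fun k _ => ?_
  rw [hp]; simp

theorem no_retract {E : Type*} [NormedAddCommGroup E] [InnerProductSpace ℝ E]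
    [FiniteDimensional ℝ E] [MeasurableSpace E] [BorelSpace E] (r : E → E)
    (hr : ∀ x ∈ closedBall (0 : E) 1, ContDiffAt ℝ 1 r x)
    (h1 : ∀ x ∈ closedBall (0 : E) 1, ‖r x‖ = 1)
    (h2 : ∀ x, ‖x‖ = 1 → r x = x) : False := by
  have hsub : ball (0 : E) 1 ⊆ closedBall 0 1 := ball_subset_closedBall
  let A : E → E →L[ℝ] E := fun x => fderiv ℝ r x - 1
  have hder : ∀ x ∈ closedBall (0 : E) 1, HasFDerivAt (fun x => r x - x) (A x) x := by
    intro x hx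
    exact ((hr x hx).differentiableAt one_ne_zero).hasFDerivAt.sub (hasFDerivAt_id x)
  have hAc : ContinuousOn A (closedBall 0 1) := by
    intro x hx
    exact (((hr x hx).continuousAt_fderiv one_ne_zero).sub continuousAt_const).continuousWithinAt
  obtain ⟨C, hC⟩ := (isCompact_closedBall (0 : E) 1).exists_bound_of_continuousOn hAc
  have hC0 : 0 ≤ C := (norm_nonneg _).trans (hC 0 (by simp))
  have hlip : ∀ x ∈ closedBall (0 : E) 1, ∀ y ∈ closedBall (0 : E) 1,
      ‖(r x - x) - (r y - y)‖ ≤ C * ‖x - y‖ := by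
    intro x hx y hy
    exact (convex_closedBall (0 : E) 1).norm_image_sub_le_of_norm_hasFDerivWithin_le
      (fun z hz => (hder z hz).hasFDerivWithinAt) hC hy hx
  classical
  let h : E → E := fun x => if ‖x‖ ≤ 1 then r x - x else 0
  have hmix : ∀ x y : E, ‖x‖ ≤ 1 → 1 < ‖y‖ → ‖r x - x‖ ≤ C * ‖x - y‖ := by
    intro x y hx hy
    have hc : ContinuousOn (fun s : ℝ => ‖AffineMap.lineMap x y s‖) (Icc 0 1) := by
      apply Continuous.continuousOn
      exact (AffineMap.lineMap_continuous).norm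
    obtain ⟨s, hs, hs1⟩ := intermediate_value_Icc (zero_le_one) hc
      (show (1 : ℝ) ∈ Icc _ _ by simp [hx, hy.le])
    have hz := h2 _ hs1
    have := hlip x (by simpa using hx) (AffineMap.lineMap x y s)
      (by simp only [mem_closedBall_zero_iff]; exact hs1.le)
    rw [hz, sub_self, sub_zero] at this
    refine this.trans (mul_le_mul_of_nonneg_left ?_ hC0)
    rw [← dist_eq_norm, ← dist_eq_norm, dist_left_lineMap]
    rw [Real.norm_of_nonneg hs.1]
    exact mul_le_of_le_one_left dist_nonneg hs.2
  have hlip' : ∀ x y : E, ‖h x - h y‖ ≤ C * ‖x - y‖ := by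
    intro x y
    by_cases hx : ‖x‖ ≤ 1 <;> by_cases hy : ‖y‖ ≤ 1
    · simp only [h, hx, hy, if_true]; exact hlip x (by simpa using hx) y (by simpa using hy)
    · simp only [h, hx, hy, if_true, if_false, sub_zero]; exact hmix x y hx (not_le.1 hy)
    · simp only [h, hx, hy, if_true, if_false, zero_sub, norm_neg]
      rw [norm_sub_rev x y]; exact hmix y x hy (not_le.1 hx)
    · simp only [h, hx, hy, if_false, sub_self, norm_zero]; positivity
  -- neighbourhood of 1 with positive det
  have hdet : Continuous (fun B : E →L[ℝ] E => B.det) := ContinuousLinearMap.continuous_det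
  obtain ⟨ε, hε, hεd⟩ : ∃ ε > 0, ∀ B : E →L[ℝ] E, ‖B‖ < ε → 0 < (1 + B).det := by
    have ho : ∀ᶠ B in 𝓝 (0 : E →L[ℝ] E), 0 < (1 + B).det := by
      have hc : Continuous (fun B : E →L[ℝ] E => (1 + B).det) := hdet.comp (by fun_prop)
      have h0 : (0 : ℝ) < (fun B : E →L[ℝ] E => (1 + B).det) 0 := by
        simp [ContinuousLinearMap.det]
      exact hc.continuousAt.eventually (lt_mem_nhds h0)
    obtain ⟨ε, hε, H⟩ := Metric.eventually_nhds_iff.1 ho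
    exact ⟨ε, hε, fun B hB => H (by simpa using hB)⟩
  obtain ⟨δ, hδ0, hδ1, hδC, hδε⟩ : ∃ δ > 0, δ < 1 ∧ δ * C < 1 ∧ δ * C < ε := by
    refine ⟨min (1/2) (min 1 ε / (C + 1) / 2), by positivity, ?_, ?_, ?_⟩
    · exact (min_le_left _ _).trans_lt (by norm_num)
    all_goals
      have h3 : min (1/2) (min 1 ε / (C + 1) / 2) * C ≤ (min 1 ε / (C + 1) / 2) * (C + 1) := by
        gcongr
        · exact min_le_right _ _
        · linarith
      have h4 : (min 1 ε / (C + 1) / 2) * (C + 1) = min 1 ε / 2 := by field_simp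
      have h5 : 0 < min 1 ε := by positivity
      have := min_le_left 1 ε
      have := min_le_right 1 ε
      linarith
  have hvol : ∀ t : ℝ, 0 < t → t ≤ δ →
      ∫ x in ball (0 : E) 1, (1 + t • A x).det = volume.real (ball (0 : E) 1) := by
    intro t ht0 htδ
    have htC : t * C < 1 := lt_of_le_of_lt (by gcongr) hδC
    have htε : t * C < ε := lt_of_le_of_lt (by gcongr) hδε
    have hinj : InjOn (fun x => x + t • (r x - x)) (ball (0 : E) 1) := by
      intro x hx y hy hxy
      have h3 := hlip x (hsub hx) y (hsub hy)
      have h4 : x - y = - (t • ((r x - x) - (r y - y))) := by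
        simp only at hxy
        rw [smul_sub t (r x - x)]
        rw [neg_sub, sub_eq_sub_iff_add_eq_add, hxy, add_comm]
      have h5 : ‖x - y‖ ≤ t * (C * ‖x - y‖) := by
        conv_lhs => rw [h4, norm_neg, norm_smul, Real.norm_of_nonneg ht0.le]
        gcongr
      have h6 : ‖x - y‖ = 0 := by nlinarith [norm_nonneg (x - y)]
      exact sub_eq_zero.1 (norm_eq_zero.1 h6)
    have himg : (fun x => x + t • (r x - x)) '' (ball (0 : E) 1) = ball 0 1 := by
      apply Subset.antisymm
      · rintro _ ⟨x, hx, rfl⟩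
        have h3 := h1 x (hsub hx)
        simp only [mem_ball_zero_iff] at hx ⊢
        have : x + t • (r x - x) = (1 - t) • x + t • r x := by module
        rw [this]
        refine (norm_add_le _ _).trans_lt ?_
        rw [norm_smul, norm_smul, h3, Real.norm_of_nonneg ht0.le,
          Real.norm_of_nonneg (by linarith)]
        nlinarith
      · intro y hy
        have hcon : ContractingWith ⟨t * C, by positivity⟩ (fun x => y - t • h x) := by
          refine ⟨by exact_mod_cast htC, LipschitzWith.of_dist_le_mul fun a b => ?_⟩
          rw [dist_eq_norm, dist_eq_norm]
          have : y - t • h a - (y - t • h b) = - (t • (h a - h b)) := by module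
          rw [this, norm_neg, norm_smul, Real.norm_of_nonneg ht0.le]
          change _ ≤ t * C * _
          rw [mul_assoc]
          gcongr
          exact hlip' a b
        have hfix : y - t • h hcon.fixedPoint = hcon.fixedPoint :=
          hcon.fixedPoint_isFixedPt
        set x := hcon.fixedPoint
        have hx : ‖x‖ < 1 := by
          by_contra hx
          have hh : h x = 0 := by
            simp only [h]
            split_ifs with hx1
            · rw [h2 x (le_antisymm hx1 (not_lt.1 hx)), sub_self]
            · rfl
          rw [hh, smul_zero, sub_zero] at hfix
          rw [← hfix] at hx
          exact hx (by simpa using hy)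
        refine ⟨x, by simpa using hx, ?_⟩
        have hh : h x = r x - x := by simp [h, hx.le]
        simp only
        rw [← hh]
        conv_lhs => rw [← hfix]
        rw [hfix]
        rw [eq_comm, ← sub_eq_iff_eq_add]; exact hfix
    have hcv := integral_image_eq_integral_abs_det_fderiv_smul (volume : Measure E)
      (s := ball (0 : E) 1) (f := fun x => x + t • (r x - x)) (f' := fun x => 1 + t • A x)
      measurableSet_ball
      (fun x hx => ((hasFDerivAt_id x).add ((hder x (hsub hx)).const_smul t)).hasFDerivWithinAt)
      hinj (fun _ => (1 : ℝ))
    rw [himg] at hcv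
    simp only [integral_const, smul_eq_mul, mul_one, measureReal_restrict_apply_univ] at hcv
    rw [hcv]
    refine setIntegral_congr_fun measurableSet_ball fun x hx => ?_
    rw [abs_of_pos]
    apply hεd
    rw [norm_smul, Real.norm_of_nonneg ht0.le]
    exact lt_of_le_of_lt (by gcongr; exact hC x (hsub hx)) htε
  let v : Fin (Module.finrank ℝ E + 1) → ℝ := fun k => δ / (k + 1)
  have hv : Function.Injective v := by
    intro i j hij
    simp only [v] at hij
    have hi : (0 : ℝ) < (i : ℝ) + 1 := by positivity
    have hj : (0 : ℝ) < (j : ℝ) + 1 := by positivity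
    rw [div_eq_div_iff hi.ne' hj.ne'] at hij
    have := mul_left_cancel₀ hδ0.ne' hij
    have h3 : (i : ℝ) = j := by linarith
    exact Fin.ext (by exact_mod_cast h3)
  have hint : ∀ t : ℝ, IntegrableOn (fun x => (1 + t • A x).det) (ball (0 : E) 1) := by
    intro t
    refine IntegrableOn.mono_set ?_ hsub
    apply ContinuousOn.integrableOn_compact (isCompact_closedBall _ _)
    exact hdet.comp_continuousOn (continuousOn_const.add (hAc.const_smul t))
  have htot : ∫ x in ball (0 : E) 1, (1 + A x).det = volume.real (ball (0 : E) 1) := by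
    rw [integral_congr_ae (Eventually.of_forall fun x => det_interp_s15 v hv (A x))]
    rw [integral_finsetSum _ (fun k _ => (hint (v k)).mul_const _)]
    have : ∀ k, ∫ x in ball (0 : E) 1, (1 + v k • A x).det *
        (Lagrange.basis Finset.univ v k).eval 1 =
        volume.real (ball (0 : E) 1) * (Lagrange.basis Finset.univ v k).eval 1 := by
      intro k
      rw [integral_mul_const, hvol (v k) (by positivity)]
      apply div_le_self hδ0.le
      have : (0 : ℝ) ≤ (k : ℝ) := by positivity
      linarith
    simp_rw [this]
    rw [← Finset.mul_sum, ← Polynomial.eval_finsetSum, Lagrange.sum_basis hv.injOn ⟨0, by simp⟩]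
    simp
  have hzero : ∫ x in ball (0 : E) 1, (1 + A x).det = 0 := by
    rw [setIntegral_congr_fun measurableSet_ball (g := fun _ => (0 : ℝ)), integral_zero]
    intro x hx
    have hA : 1 + A x = fderiv ℝ r x := by simp [A]
    simp only [hA]
    by_contra hne
    have hd : HasFDerivAt r (fderiv ℝ r x) x :=
      ((hr x (hsub hx)).differentiableAt one_ne_zero).hasFDerivAt
    have hn := hd.norm_sq
    have hc : HasFDerivAt (fun y => ‖r y‖ ^ 2) (0 : E →L[ℝ] ℝ) x := by
      refine (hasFDerivAt_const (1 : ℝ) x).congr_of_eventuallyEq ?_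
      filter_upwards [isOpen_ball.mem_nhds hx] with y hy
      simp [h1 y (hsub hy)]
    have huniq := hn.unique hc
    have hsurj : Function.Surjective (fderiv ℝ r x) := by
      exact (LinearMap.equivOfDetNeZero (fderiv ℝ r x : E →ₗ[ℝ] E) hne).surjective
    obtain ⟨w, hw⟩ := hsurj (r x)
    have := congrArg (fun L : E →L[ℝ] ℝ => L w) huniq
    simp [hw, h1 x (hsub hx)] at this
  rw [hzero] at htot
  have : 0 < volume.real (ball (0 : E) 1) :=
    ENNReal.toReal_pos (measure_ball_pos _ _ one_pos).ne' measure_ball_lt_top.ne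
  linarith

theorem brouwer_smooth {E : Type*} [NormedAddCommGroup E] [InnerProductSpace ℝ E]
    [FiniteDimensional ℝ E] [MeasurableSpace E] [BorelSpace E] (f : E → E)
    (hf : ContDiff ℝ 1 f) (hb : ∀ x, ‖f x‖ ≤ 1) : ∃ x, f x = x := by
  by_contra! hne
  let u : E → E := fun x => x - f x
  let a : E → ℝ := fun x => inner ℝ (u x) (u x)
  let b : E → ℝ := fun x => inner ℝ x (u x)
  let c : E → ℝ := fun x => 1 - inner ℝ x x
  let D : E → ℝ := fun x => b x ^ 2 + a x * c x
  let s : E → ℝ := fun x => (-b x + √(D x)) / a x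
  have hu : ContDiff ℝ 1 u := contDiff_id.sub hf
  have ha : ContDiff ℝ 1 a := hu.inner ℝ hu
  have hbc : ContDiff ℝ 1 b := contDiff_id.inner ℝ hu
  have hc : ContDiff ℝ 1 c := contDiff_const.sub (contDiff_id.inner ℝ contDiff_id)
  have hD : ContDiff ℝ 1 D := (hbc.pow 2).add (ha.mul hc)
  have hapos : ∀ x, 0 < a x := by
    intro x
    have : u x ≠ 0 := fun h => hne x (sub_eq_zero.1 h).symm
    exact real_inner_self_pos.2 this
  have hfx : ∀ x, a x - c x ≤ 2 * b x := by
    intro x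
    have h1 : inner ℝ (f x) (f x) ≤ (1 : ℝ) := by
      rw [real_inner_self_eq_norm_sq]; nlinarith [hb x, norm_nonneg (f x)]
    have h2 : f x = x - u x := by simp [u]
    have h3 : ∀ v w : E, inner ℝ (v - w) (v - w) = inner ℝ v v - 2 * inner ℝ v w + inner ℝ w w := by
      intro v w
      simp only [inner_sub_left, inner_sub_right, real_inner_comm v w]
      ring
    rw [h2, h3] at h1
    simp only [a, b, c]
    linarith
  have hcn : ∀ x ∈ closedBall (0 : E) 1, 0 ≤ c x := by
    intro x hx
    simp only [mem_closedBall_zero_iff] at hx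
    simp only [c, real_inner_self_eq_norm_sq]
    nlinarith [norm_nonneg x]
  have hDpos : ∀ x ∈ closedBall (0 : E) 1, 0 < D x := by
    intro x hx
    have h1 := hcn x hx
    have h2 := hapos x
    have h3 := hfx x
    simp only [D]
    rcases h1.eq_or_lt with h | h
    · rw [← h] at h3 ⊢
      have : 0 < b x := by linarith
      positivity
    · positivity
  refine no_retract (fun x => x + s x • u x) ?_ ?_ ?_
  · intro x hx
    refine contDiffAt_id.add (ContDiffAt.smul ?_ hu.contDiffAt)
    exact ((hbc.contDiffAt.neg).add (hD.contDiffAt.sqrt (hDpos x hx).ne')).div ha.contDiffAt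
      (hapos x).ne'
  · intro x hx
    have h1 : ‖x + s x • u x‖ ^ 2 = 1 := by
      rw [← real_inner_self_eq_norm_sq]
      have : inner ℝ (x + s x • u x) (x + s x • u x)
          = 1 + (s x ^ 2 * a x + 2 * s x * b x - c x) := by
        simp only [inner_add_left, inner_add_right, inner_smul_left, inner_smul_right, a, b, c,
          real_inner_comm x (u x)]
        simp
        ring
      rw [this]
      have h4 := Real.sq_sqrt (hDpos x hx).le
      have h5 := (hapos x).ne'
      have h6 : s x * a x = -b x + √(D x) := by simp only [s]; field_simp
      have h7 : a x * (s x ^ 2 * a x + 2 * s x * b x - c x) = 0 := by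
        have : a x * (s x ^ 2 * a x + 2 * s x * b x - c x)
          = (s x * a x) ^ 2 + 2 * (s x * a x) * b x - a x * c x := by ring
        rw [this, h6]
        simp only [D] at h4 ⊢
        linear_combination h4
      rcases mul_eq_zero.1 h7 with h | h
      · exact absurd h h5
      · rw [h]; ring
    have := norm_nonneg (x + s x • u x)
    nlinarith
  · intro x hx
    have hc0 : c x = 0 := by simp [c, hx]
    have h3 := hfx x
    have h2 := hapos x
    have hs : s x = 0 := by
      simp only [s, D, hc0, mul_zero, add_zero]
      rw [Real.sqrt_sq (by linarith)]
      simp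
    simp [hs]

open scoped Manifold ContDiff in
theorem brouwer_ball {E : Type*} [NormedAddCommGroup E] [InnerProductSpace ℝ E]
    [FiniteDimensional ℝ E] [MeasurableSpace E] [BorelSpace E] (f : E → E)
    (hf : Continuous f) (hb : ∀ x, ‖f x‖ ≤ 1) : ∃ x, f x = x := by
  by_contra! hne
  obtain ⟨x₀, -, hx₀⟩ := (isCompact_closedBall (0 : E) 1).exists_isMinOn ⟨0, by simp⟩
    (f := fun x => ‖f x - x‖) (by fun_prop)
  set d := ‖f x₀ - x₀‖ with hd
  have hdpos : 0 < d := norm_pos_iff.2 (sub_ne_zero.2 (hne x₀))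
  set ε := d / 4 with hε
  have hεpos : 0 < ε := by positivity
  obtain ⟨g, hg⟩ := exists_contMDiffMap_forall_mem_convex_of_local_const (n := 1) (𝓘(ℝ, E))
    (t := fun x => ball (f x) ε) (fun x => convex_ball _ _) (fun x => ⟨f x, by
      have := hf.continuousAt.eventually (ball_mem_nhds (f x) hεpos)
      filter_upwards [this] with y hy
      rw [mem_ball, dist_comm]; exact hy⟩)
  have hgs : ContDiff ℝ 1 g := g.contMDiff.contDiff
  have hgn : ∀ x, ‖g x‖ ≤ 1 + ε := by
    intro x
    have h1 := hg x
    rw [mem_ball, dist_eq_norm] at h1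
    have : g x = (g x - f x) + f x := by abel
    rw [this]
    exact (norm_add_le _ _).trans (by linarith [hb x])
  obtain ⟨x, hx⟩ := brouwer_smooth (fun x => (1 + ε)⁻¹ • g x) (hgs.const_smul _) (by
    intro x
    rw [norm_smul, Real.norm_of_nonneg (by positivity), inv_mul_le_iff₀ (by positivity)]
    simpa using hgn x)
  have hgx : g x = (1 + ε) • x := by
    rw [← hx, smul_smul, mul_inv_cancel₀ (by positivity), one_smul, hx]
  have hxn : ‖x‖ ≤ 1 := by
    have := hgn x
    rw [hgx, norm_smul, Real.norm_of_nonneg (by positivity)] at this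
    nlinarith
  have h1 : d ≤ ‖f x - x‖ := hx₀ (by simpa using hxn)
  have h2 := hg x
  rw [mem_ball, dist_eq_norm] at h2
  have h3 : f x - x = -(g x - f x) + ε • x := by rw [hgx]; module
  rw [h3] at h1
  have h4 := norm_add_le (-(g x - f x)) (ε • x)
  rw [norm_neg, norm_smul, Real.norm_of_nonneg hεpos.le] at h4
  nlinarith

/-- Brouwer on the simplex, in a retracted form. -/
theorem brouwer_simplex {n : ℕ} (g : (Fin (n+1) → ℝ) → Fin (n+1) → ℝ)
    (hg : ContinuousOn g (stdSimplex ℝ (Fin (n+1))))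
    (hm : ∀ x ∈ stdSimplex ℝ (Fin (n+1)), g x ∈ stdSimplex ℝ (Fin (n+1))) :
    ∃ x ∈ stdSimplex ℝ (Fin (n+1)), g x = x := by
  let S : (Fin (n+1) → ℝ) → ℝ := fun x => ∑ i, max (x i) 0
  let q : (Fin (n+1) → ℝ) → ℝ := fun x => max (1 - S x) 0
  let r : (Fin (n+1) → ℝ) → Fin (n+1) → ℝ := fun x i =>
    (max (x i) 0 + q x / (n + 1)) / (S x + q x)
  have hS0 : ∀ x, 0 ≤ S x := fun x => Finset.sum_nonneg fun i _ => le_max_right _ _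
  have hq0 : ∀ x, 0 ≤ q x := fun x => le_max_right _ _
  have hden : ∀ x, 0 < S x + q x := by
    intro x
    have := le_max_left (1 - S x) 0
    simp only [q]; linarith
  have hr : ∀ x, r x ∈ stdSimplex ℝ (Fin (n+1)) := by
    intro x
    refine ⟨fun i => ?_, ?_⟩
    · have := hq0 x
      have := hden x
      have := le_max_right (x i) 0
      simp only [r]; positivity
    · simp only [r]
      rw [← Finset.sum_div, Finset.sum_add_distrib, Finset.sum_const, div_eq_one_iff_eq (hden x).ne']
      simp [S]
      field_simp
  have hrc : Continuous r := by
    have hSc : Continuous S := by fun_prop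
    have hqc : Continuous q := by fun_prop
    refine continuous_pi fun i => ?_
    exact Continuous.div (by fun_prop) (by fun_prop) fun x => (hden x).ne'
  have hrid : ∀ x ∈ stdSimplex ℝ (Fin (n+1)), r x = x := by
    intro x hx
    have h1 : ∀ i, max (x i) 0 = x i := fun i => max_eq_left (hx.1 i)
    have h2 : S x = 1 := by simp only [S, h1]; exact hx.2
    funext i
    simp [r, q, h1, h2]
  obtain ⟨y, hy⟩ := brouwer_ball (E := EuclideanSpace ℝ (Fin (n+1)))
    (fun x => WithLp.toLp 2 (g (r (WithLp.ofLp x)))) (by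
      have : Continuous (fun x => g (r x)) := by
        rw [← continuousOn_univ]
        exact hg.comp hrc.continuousOn (fun x _ => hr x)
      exact (PiLp.continuous_toLp 2 _).comp (this.comp (PiLp.continuous_ofLp 2 _))) (by
      intro x
      have := hm _ (hr (WithLp.ofLp x))
      set z := g (r (WithLp.ofLp x))
      rw [EuclideanSpace.norm_eq, Real.sqrt_le_one]
      rw [← this.2]
      refine Finset.sum_le_sum fun i _ => ?_
      have h1 := this.1 i
      have h2 : z i ≤ 1 := by
        rw [← this.2]; exact Finset.single_le_sum (fun j _ => this.1 j) (Finset.mem_univ i)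
      simp only [Real.norm_eq_abs, sq_abs]
      nlinarith)
  have hy' : g (r (WithLp.ofLp y)) = WithLp.ofLp y := by
    conv_rhs => rw [← hy]
  have hyS : WithLp.ofLp y ∈ stdSimplex ℝ (Fin (n+1)) := hy' ▸ hm _ (hr _)
  exact ⟨_, hyS, by rw [hrid _ hyS] at hy'; exact hy'⟩

theorem schauder {V : Type*} [NormedAddCommGroup V] [NormedSpace ℝ V] (K : Set V)
    (hK : IsCompact K) (hKc : Convex ℝ K) (hKn : K.Nonempty) (T : V → V)
    (hT : ContinuousOn T K) (hTm : MapsTo T K K) : ∃ x ∈ K, T x = x := by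
  have key : ∀ ε > 0, ∃ x ∈ K, ‖T x - x‖ ≤ ε := by
    intro ε hε
    obtain ⟨t, htK, htf, htc⟩ := hK.finite_cover_balls hε
    obtain ⟨x₁, hx₁⟩ := hKn
    have htn : t.Nonempty := by
      have := htc hx₁
      simp only [mem_iUnion] at this
      obtain ⟨i, hi, _⟩ := this
      exact ⟨i, hi⟩
    have : Finite t := htf
    have : Nonempty t := htn.to_subtype
    obtain ⟨m, ⟨e⟩⟩ := Finite.exists_equiv_fin t
    obtain ⟨n, rfl⟩ : ∃ n, m = n + 1 := by
      refine Nat.exists_eq_succ_of_ne_zero ?_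
      rintro rfl
      exact (e (Classical.arbitrary t)).elim0
    let p : Fin (n+1) → V := fun i => (e.symm i : V)
    have hpK : ∀ i, p i ∈ K := fun i => htK (e.symm i).2
    let w : V → Fin (n+1) → ℝ := fun y i => max (ε - ‖y - p i‖) 0
    let W : V → ℝ := fun y => ∑ i, w y i
    have hw0 : ∀ y i, 0 ≤ w y i := fun y i => le_max_right _ _
    have hW : ∀ y ∈ K, 0 < W y := by
      intro y hy
      have := htc hy
      simp only [mem_iUnion] at this
      obtain ⟨z, hz, hyz⟩ := this
      refine Finset.sum_pos' (fun i _ => hw0 y i) ⟨e ⟨z, hz⟩, Finset.mem_univ _, ?_⟩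
      simp only [w, p, Equiv.symm_apply_apply]
      rw [mem_ball, dist_eq_norm] at hyz
      exact lt_max_of_lt_left (by linarith)
    let P : (Fin (n+1) → ℝ) → V := fun l => ∑ i, l i • p i
    have hP : ∀ l ∈ stdSimplex ℝ (Fin (n+1)), P l ∈ K := fun l hl =>
      hKc.sum_mem (fun i _ => hl.1 i) hl.2 (fun i _ => hpK i)
    have hPc : Continuous P := by fun_prop
    have hTP : ContinuousOn (fun l => T (P l)) (stdSimplex ℝ (Fin (n+1))) :=
      hT.comp hPc.continuousOn hP
    have hwc : ∀ i, Continuous (fun y => w y i) := by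
      intro i; fun_prop
    have hWc : Continuous W := by fun_prop
    obtain ⟨l, hl, hfix⟩ := brouwer_simplex (fun l i => w (T (P l)) i / W (T (P l))) (by
      refine continuousOn_pi.2 fun i => ?_
      exact ((hwc i).comp_continuousOn hTP).div (hWc.comp_continuousOn hTP)
        (fun l hl => (hW _ (hTm (hP l hl))).ne')) (by
      intro l hl
      have h0 := hW _ (hTm (hP l hl))
      refine ⟨fun i => div_nonneg (hw0 _ _) h0.le, ?_⟩
      rw [← Finset.sum_div]; exact div_self h0.ne')
    refine ⟨P l, hP l hl, ?_⟩
    set y := T (P l) with hy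
    have h0 := hW _ (hTm (hP l hl))
    rw [← hy] at h0
    have hli : ∀ i, l i = w y i / W y := fun i => by rw [← hfix]
    have h1 : y - P l = ∑ i, l i • (y - p i) := by
      simp only [smul_sub, Finset.sum_sub_distrib, ← Finset.sum_smul, hl.2, one_smul, P]
    rw [h1]
    calc ‖∑ i, l i • (y - p i)‖ ≤ ∑ i, ‖l i • (y - p i)‖ := norm_sum_le _ _
      _ ≤ ∑ i, l i * ε := by
        refine Finset.sum_le_sum fun i _ => ?_
        rw [norm_smul, Real.norm_of_nonneg (hl.1 i)]
        rcases le_or_gt ‖y - p i‖ ε with h | h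
        · exact mul_le_mul_of_nonneg_left h (hl.1 i)
        · have : l i = 0 := by
            rw [hli]; simp only [w]; rw [max_eq_right (by linarith)]; simp
          simp [this]
      _ = ε := by rw [← Finset.sum_mul, hl.2, one_mul]
  obtain ⟨x, hx, hmin⟩ := hK.exists_isMinOn hKn (f := fun x => ‖T x - x‖)
    ((hT.sub continuousOn_id).norm)
  refine ⟨x, hx, ?_⟩
  by_contra hne
  have hpos : 0 < ‖T x - x‖ := norm_pos_iff.2 (sub_ne_zero.2 hne)
  obtain ⟨y, hy, hy2⟩ := key (‖T x - x‖ / 2) (by positivity)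
  have : ‖T x - x‖ ≤ ‖T y - y‖ := hmin hy
  linarith

noncomputable def nP (h : ℝ → ℝ) (t : ℝ) : ℝ :=
  (Real.exp (2 * (2 * Real.pi)) - 1)⁻¹ * ∫ s in (0 : ℝ)..(2 * Real.pi), Real.exp (2 * s) * h (t + s)

theorem nP_const_pos : 0 < Real.exp (2 * (2 * Real.pi)) - 1 := by
  have : 1 < Real.exp (2 * (2 * Real.pi)) := by
    rw [Real.one_lt_exp_iff]; positivity
  linarith

theorem nP_int : ∫ s in (0 : ℝ)..(2 * Real.pi), Real.exp (2 * s)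
    = (Real.exp (2 * (2 * Real.pi)) - 1) / 2 := by
  rw [intervalIntegral.integral_comp_mul_left (fun s => Real.exp s) (two_ne_zero)]
  simp
  ring

theorem nP_ii {h : ℝ → ℝ} (hc : Continuous h) (t : ℝ) :
    IntervalIntegrable (fun s => Real.exp (2 * s) * h (t + s)) volume 0 (2 * Real.pi) := by
  apply Continuous.intervalIntegrable
  fun_prop

theorem nP_ge {h : ℝ → ℝ} (hc : Continuous h) {m : ℝ} (hm : ∀ t, 2 * m ≤ h t) (t : ℝ) :
    m ≤ nP h t := by
  have h0 := nP_const_pos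
  rw [nP, inv_mul_eq_div, le_div_iff₀ h0]
  have h1 : ∫ s in (0 : ℝ)..(2 * Real.pi), Real.exp (2 * s) * (2 * m)
      ≤ ∫ s in (0 : ℝ)..(2 * Real.pi), Real.exp (2 * s) * h (t + s) := by
    apply intervalIntegral.integral_mono_on (by positivity) _ (nP_ii hc t)
    · intro s _
      exact mul_le_mul_of_nonneg_left (hm _) (Real.exp_pos _).le
    · apply Continuous.intervalIntegrable
      fun_prop
  rw [intervalIntegral.integral_mul_const, nP_int] at h1
  linarith

theorem nP_sub {h k : ℝ → ℝ} (hc : Continuous h) (kc : Continuous k) (t : ℝ) :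
    nP (fun s => h s - k s) t = nP h t - nP k t := by
  simp only [nP, mul_sub]
  rw [intervalIntegral.integral_sub (nP_ii hc t) (nP_ii kc t)]
  ring

theorem nP_const (c t : ℝ) : nP (fun _ => 2 * c) t = c := by
  have h0 := nP_const_pos
  rw [nP, intervalIntegral.integral_mul_const, nP_int]
  set q := Real.exp (2 * (2 * Real.pi)) - 1
  field_simp

theorem nP_le {h : ℝ → ℝ} (hc : Continuous h) {m : ℝ} (hm : ∀ t, h t ≤ 2 * m) (t : ℝ) :
    nP h t ≤ m := by
  have h1 := nP_ge (h := fun s => 2 * m - h s) (by fun_prop) (m := 0)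
    (fun s => by linarith [hm s]) t
  rw [nP_sub (by fun_prop) hc, nP_const] at h1
  linarith

theorem nP_dist {h k : ℝ → ℝ} (hc : Continuous h) (kc : Continuous k) {d : ℝ}
    (hd : ∀ t, |h t - k t| ≤ 2 * d) (t : ℝ) : |nP h t - nP k t| ≤ d := by
  rw [← nP_sub hc kc, abs_le]
  exact ⟨nP_ge (by fun_prop) (fun s => by linarith [(abs_le.1 (hd s)).1]) t,
    nP_le (by fun_prop) (fun s => (abs_le.1 (hd s)).2) t⟩

theorem nP_periodic {h : ℝ → ℝ} (hp : Function.Periodic h (2 * Real.pi)) :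
    Function.Periodic (nP h) (2 * Real.pi) := by
  intro t
  simp only [nP]
  congr 2
  funext s
  rw [← hp (t + s)]
  congr 2
  ring

theorem nP_deriv {h : ℝ → ℝ} (hc : Continuous h) (hp : Function.Periodic h (2 * Real.pi)) (t : ℝ) :
    HasDerivAt (nP h) (-2 * nP h t + h t) t := by
  have h0 := nP_const_pos
  set q := Real.exp (2 * (2 * Real.pi)) - 1 with hq
  let G : ℝ → ℝ := fun y => ∫ x in (0 : ℝ)..y, Real.exp (2 * x) * h x
  have hcG : Continuous (fun x => Real.exp (2 * x) * h x) := by fun_prop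
  have hG : ∀ y, HasDerivAt G (Real.exp (2 * y) * h y) y := fun y =>
    hcG.integral_hasStrictDerivAt 0 y |>.hasDerivAt
  have hform : ∀ y, nP h y = q⁻¹ * (Real.exp (-(2 * y)) * (G (y + 2 * Real.pi) - G y)) := by
    intro y
    have h1 : G (y + 2 * Real.pi) - G y
        = ∫ x in y..(y + 2 * Real.pi), Real.exp (2 * x) * h x :=
      intervalIntegral.integral_interval_sub_left (hcG.intervalIntegrable _ _)
        (hcG.intervalIntegrable _ _)
    have h2 := intervalIntegral.integral_comp_add_left
      (fun x => Real.exp (2 * x) * h x) (a := 0) (b := 2 * Real.pi) y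
    rw [add_zero] at h2
    rw [h1, ← h2, nP, ← hq, ← intervalIntegral.integral_const_mul (Real.exp (-(2 * y)))]
    congr 2
    funext s
    rw [← mul_assoc, ← Real.exp_add]
    congr 2
    ring
  have hfun : nP h = fun y => q⁻¹ * (Real.exp (-(2 * y)) * (G (y + 2 * Real.pi) - G y)) :=
    funext hform
  have hd1 : HasDerivAt (fun y : ℝ => Real.exp (-(2 * y))) (Real.exp (-(2 * t)) * (-(2 * 1))) t :=
    (((hasDerivAt_id t).const_mul 2).neg).exp
  have hd2 : HasDerivAt (fun y => G (y + 2 * Real.pi)) 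
      (Real.exp (2 * (t + 2 * Real.pi)) * h (t + 2 * Real.pi)) t :=
    (hG (t + 2 * Real.pi)).comp_add_const t (2 * Real.pi)
  have hd := (hd1.mul (hd2.sub (hG t))).const_mul q⁻¹
  rw [hfun]
  refine hd.congr_deriv ?_
  simp only [Pi.sub_apply]
  rw [hp t]
  have e1 : Real.exp (-(2 * t)) * Real.exp (2 * (t + 2 * Real.pi)) = q + 1 := by
    rw [← Real.exp_add, hq]; ring_nf
  have e2 : Real.exp (-(2 * t)) * Real.exp (2 * t) = 1 := by
    rw [← Real.exp_add]; simp
  have e3 : q⁻¹ * q = 1 := inv_mul_cancel₀ h0.ne'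
  linear_combination (q⁻¹ * h t) * e1 - (q⁻¹ * h t) * e2 + h t * e3

theorem nP_lip {h : ℝ → ℝ} (hc : Continuous h) (hp : Function.Periodic h (2 * Real.pi)) {m M : ℝ}
    (hm : 0 < m) (h1 : ∀ t, 2 * m ≤ h t) (h2 : ∀ t, h t ≤ 2 * M) (x y : ℝ) :
    |nP h x - nP h y| ≤ 2 * M * |x - y| := by
  have := convex_univ.norm_image_sub_le_of_norm_hasDerivWithin_le (f := nP h)
    (f' := fun t => -2 * nP h t + h t) (C := 2 * M) (s := Set.univ) (x := y) (y := x)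
    (fun t _ => (nP_deriv hc hp t).hasDerivWithinAt) (fun t _ => by
      have a1 := nP_ge hc h1 t
      have a2 := nP_le hc h2 t
      have a3 := h1 t
      have a4 := h2 t
      rw [Real.norm_eq_abs, abs_le]
      constructor <;> linarith) trivial trivial
  simpa using this

theorem nf_low {m w : ℝ} (hm : m = Real.exp (-100)) (h1 : m ≤ w) (h2 : w ≤ 100) :
    m / 2 ≤ w * Real.exp (-w) := by
  have hm0 : 0 < m := hm ▸ Real.exp_pos _
  rcases le_or_gt w (1 / 2) with h | h
  · have := Real.add_one_le_exp (-w)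
    nlinarith
  · have : m ≤ Real.exp (-w) := by rw [hm]; exact Real.exp_le_exp.2 (by linarith)
    nlinarith

theorem nf_up (w : ℝ) : w * Real.exp (-w) ≤ 0.368 := by
  have h1 : w * Real.exp (-w) ≤ Real.exp (-1) := by
    have h := Real.add_one_le_exp (w - 1)
    have h3 : Real.exp (-1) = Real.exp (w - 1) * Real.exp (-w) := by
      rw [← Real.exp_add]; ring_nf
    rw [h3]
    have := Real.exp_pos (-w)
    nlinarith
  have := Real.exp_neg_one_lt_d9
  linarith

theorem nf_lip {u v : ℝ} (hu : 0 ≤ u) (hv : 0 ≤ v) :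
    |u * Real.exp (-u) - v * Real.exp (-v)| ≤ |u - v| := by
  have := (convex_Ici (0 : ℝ)).norm_image_sub_le_of_norm_hasDerivWithin_le
    (f := fun u => u * Real.exp (-u)) (f' := fun u => 1 * Real.exp (-u) + u * (Real.exp (-u) * (-1)))
    (C := 1) (x := v) (y := u)
    (fun t _ => ((hasDerivAt_id t).mul ((hasDerivAt_id t).neg.exp)).hasDerivWithinAt)
    (fun t ht => by
      have ht' : 0 ≤ t := ht
      have e1 : Real.exp (-t) * Real.exp t = 1 := by rw [← Real.exp_add]; simp
      have e2 := Real.add_one_le_exp t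
      have e3 := Real.exp_pos (-t)
      have e4 : Real.exp (-t) ≤ 1 := by rw [Real.exp_le_one_iff]; linarith
      rw [Real.norm_eq_abs, abs_le]
      constructor <;> nlinarith) hv hu
  simpa using this

theorem nq_lip {k u v : ℝ} (hk : 0 < k) (hu : 0 ≤ u) (hv : 0 ≤ v) :
    |u / (k + u) - v / (k + v)| ≤ |u - v| / k := by
  have h1 : 0 < k + u := by linarith
  have h2 : 0 < k + v := by linarith
  have : u / (k + u) - v / (k + v) = (u - v) * (k / ((k + u) * (k + v))) := by
    field_simp; ring
  rw [this, abs_mul, div_eq_mul_inv |u - v|]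
  refine mul_le_mul_of_nonneg_left ?_ (abs_nonneg _)
  rw [abs_of_pos (by positivity), div_le_iff₀ (by positivity), inv_mul_eq_div, le_div_iff₀ hk]
  nlinarith [mul_nonneg hu hv]

/-- The nonlinear right-hand side, with amplitude parameters. -/
noncomputable def nH (p q r k u v w : ℝ) : ℝ :=
  2 * u - p * (u / (4 + u)) + q * (w * Real.exp (-w)) + r * (v / (k + v))

theorem nH_lip {p q r k u v w u' v' w' d : ℝ} (hp : 0 ≤ p) (hp' : p ≤ 6) (hq : 0 ≤ q)
    (hq' : q ≤ 4) (hr : 0 ≤ r) (hr' : r ≤ 2.5) (hk : 2 ≤ k) (hu : 0 ≤ u) (hu' : 0 ≤ u')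
    (hv : 0 ≤ v) (hv' : 0 ≤ v') (hw : 0 ≤ w) (hw' : 0 ≤ w')
    (du : |u - u'| ≤ d) (dv : |v - v'| ≤ d) (dw : |w - w'| ≤ d) :
    |nH p q r k u v w - nH p q r k u' v' w'| ≤ 2 * (5 * d) := by
  have hd : 0 ≤ d := (abs_nonneg _).trans du
  have e1 := (nq_lip (by norm_num : (0:ℝ) < 4) hu hu').trans (div_le_div_of_nonneg_right du (by norm_num))
  have e2 := (nq_lip (by linarith : 0 < k) hv hv').trans
    ((div_le_div_of_nonneg_right dv (by linarith)).trans
      (div_le_div_of_nonneg_left hd (by norm_num) hk))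
  have e3 := (nf_lip hw hw').trans dw
  have : nH p q r k u v w - nH p q r k u' v' w' = 2 * (u - u')
    - p * (u / (4 + u) - u' / (4 + u')) + q * (w * Real.exp (-w) - w' * Real.exp (-w'))
    + r * (v / (k + v) - v' / (k + v')) := by
    simp only [nH]; ring
  rw [this]
  set X := u / (4 + u) - u' / (4 + u')
  set Y := w * Real.exp (-w) - w' * Real.exp (-w')
  set Z := v / (k + v) - v' / (k + v')
  have f1 : |p * X| ≤ 6 * (d / 4) := by
    rw [abs_mul, abs_of_nonneg hp]; gcongr
  have f2 : |q * Y| ≤ 4 * d := by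
    rw [abs_mul, abs_of_nonneg hq]; gcongr
  have f3 : |r * Z| ≤ 2.5 * (d / 2) := by
    rw [abs_mul, abs_of_nonneg hr]; gcongr
  rw [abs_le] at *
  constructor <;> linarith

theorem nH_up {p q r k u v w M N p0 q0 r0 : ℝ} (hp : p0 ≤ p) (hp0 : 0 ≤ p0) (hp' : p0 ≤ 8)
    (hq : 0 ≤ q)
    (hq' : q ≤ q0) (hr : 0 ≤ r) (hr' : r ≤ r0) (hk : 2 ≤ k) (hu : 0 ≤ u) (huM : u ≤ M)
    (hv : 0 ≤ v) (hvN : v ≤ N) (hw : 0 ≤ w)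
    (hfin : q0 * 0.368 + r0 * (N / (k + N)) ≤ p0 * (M / (4 + M))) :
    nH p q r k u v w ≤ 2 * M := by
  have e1 : M / (4 + M) - u / (4 + u) ≤ (M - u) / 4 := by
    have := nq_lip (by norm_num : (0:ℝ) < 4) (hu.trans huM) hu
    rw [abs_of_nonneg (by linarith : 0 ≤ M - u)] at this
    exact (le_abs_self _).trans this
  have e2 : v / (k + v) ≤ N / (k + N) := by
    rw [div_le_div_iff₀ (by linarith) (by linarith)]
    nlinarith
  have e3 := nf_up w
  have g1 : p0 * (u / (4 + u)) ≤ p * (u / (4 + u)) := by gcongr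
  have g2 : q * (w * Real.exp (-w)) ≤ q0 * 0.368 := by
    gcongr
    linarith
  have g3 : r * (v / (k + v)) ≤ r0 * (N / (k + N)) := by
    gcongr
    linarith
  have g4 : p0 * (M / (4 + M) - u / (4 + u)) ≤ p0 * ((M - u) / 4) := by gcongr
  have g5 : p0 * ((M - u) / 4) ≤ 8 * ((M - u) / 4) := by
    gcongr
  simp only [nH]
  linarith

theorem nH_low {p q r k u v w m p1 q1 r1 : ℝ} (hm : m = Real.exp (-100)) (hp : p ≤ p1)
    (hp1 : 0 ≤ p1) (hp' : p1 ≤ 8) (hq : q1 ≤ q) (hq1 : 0 ≤ q1) (hr : r1 ≤ r) (hr1 : 0 ≤ r1) (hk : 2 ≤ k)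
    (hk' : k ≤ 3) (hu : m ≤ u) (hv : m ≤ v) (hw : m ≤ w) (hw' : w ≤ 100)
    (hfin : p1 / 4 ≤ q1 / 2 + r1 / (k + 0.01)) :
    2 * m ≤ nH p q r k u v w := by
  have hm0 : 0 < m := hm ▸ Real.exp_pos _
  have hm1 : m ≤ 0.01 := by
    have h := Real.add_one_le_exp (100 : ℝ)
    have h2 : m * Real.exp 100 = 1 := by rw [hm, ← Real.exp_add]; simp
    nlinarith
  have e1 : u / (4 + u) ≤ u / 4 := by
    apply div_le_div_of_nonneg_left <;> linarith
  have e2 : m / (k + 0.01) ≤ v / (k + v) := by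
    rw [div_le_div_iff₀ (by linarith) (by linarith)]
    nlinarith
  have e3 := nf_low hm hw hw'
  have g0 : 0 ≤ u / (4 + u) := div_nonneg (by linarith) (by linarith)
  have g1 : p * (u / (4 + u)) ≤ p1 * (u / (4 + u)) := by gcongr
  have g6 : p1 * (u / (4 + u)) - p1 * (m / 4) ≤ 2 * u - 2 * m := by
    have e0 : u / (4 + u) - m / 4 ≤ (u - m) / 4 := by linarith
    have : p1 * (u / (4 + u) - m / 4) ≤ 8 * ((u - m) / 4) := by
      calc _ ≤ p1 * ((u - m) / 4) := by gcongr
        _ ≤ _ := by gcongr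
    linarith
  have g2 : q1 * (m / 2) ≤ q * (w * Real.exp (-w)) := by
    gcongr
    linarith
  have g3 : r1 * (m / (k + 0.01)) ≤ r * (v / (k + v)) := by
    gcongr
    linarith
  have g4 := mul_le_mul_of_nonneg_right hfin hm0.le
  have g5 : (q1 / 2 + r1 / (k + 0.01)) * m = q1 * (m / 2) + r1 * (m / (k + 0.01)) := by ring
  simp only [nH]
  linarith

/-- The compact convex set of circle functions with values in `[m, M]` and Lipschitz lift. -/
def nK (m M : ℝ) : Set (BoundedContinuousFunction (AddCircle (2 * Real.pi)) ℝ) :=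
  {φ | (∀ t, φ t ∈ Set.Icc m M) ∧ ∀ x y : ℝ, |φ (x : AddCircle (2 * Real.pi)) - φ y| ≤ 2 * M * |x - y|}

theorem nK_compact (m M : ℝ) : IsCompact (nK m M) := by
  have : Fact (0 < 2 * Real.pi) := ⟨by positivity⟩
  refine BoundedContinuousFunction.arzela_ascoli₂ (Set.Icc m M) isCompact_Icc _ ?_
    (fun f x hf => hf.1 x) ?_
  · have hev : ∀ t, Continuous
        (fun φ : BoundedContinuousFunction (AddCircle (2 * Real.pi)) ℝ => φ t) :=
      fun t => continuous_eval_const t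
    have e : nK m M = (⋂ t, {φ | φ t ∈ Set.Icc m M}) ∩
        ⋂ x : ℝ, ⋂ y : ℝ, {φ | |φ (x : AddCircle (2 * Real.pi)) - φ y| ≤ 2 * M * |x - y|} := by
      ext φ
      simp [nK]
    rw [e]
    refine (isClosed_iInter fun t => isClosed_Icc.preimage (hev t)).inter
      (isClosed_iInter fun x => isClosed_iInter fun y => ?_)
    exact isClosed_le ((hev _).sub (hev _)).abs continuous_const
  · intro a
    induction a using QuotientAddGroup.induction_on with
    | H x =>
      rw [Metric.equicontinuousAt_iff_right]
      intro ε hε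
      have hmap : map ((↑) : ℝ → AddCircle (2 * Real.pi)) (𝓝 x) = 𝓝 (x : AddCircle (2 * Real.pi)) :=
        (QuotientAddGroup.nhds_eq _ x).symm
      change ∀ᶠ b in 𝓝 (x : AddCircle (2 * Real.pi)), _
      rw [← hmap, eventually_map]
      have hc : Continuous (fun y : ℝ => 2 * M * |x - y|) := by fun_prop
      have h0 : (fun y : ℝ => 2 * M * |x - y|) x < ε := by simpa using hε
      filter_upwards [hc.continuousAt.eventually (gt_mem_nhds h0)] with y hy
      intro i
      rw [Real.dist_eq]
      exact (i.2.2 x y).trans_lt hy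

theorem nK_convex (m M : ℝ) : Convex ℝ (nK m M) := by
  intro φ hφ ψ hψ a b ha hb hab
  refine ⟨fun t => (convex_Icc m M) (hφ.1 t) (hψ.1 t) ha hb hab, fun x y => ?_⟩
  have h1 := hφ.2 x y
  have h2 := hψ.2 x y
  simp only [BoundedContinuousFunction.coe_add, BoundedContinuousFunction.coe_smul, Pi.add_apply, smul_eq_mul]
  have e : a * φ (x : AddCircle (2 * Real.pi)) + b * ψ x - (a * φ y + b * ψ y)
      = a * (φ x - φ y) + b * (ψ x - ψ y) := by ring
  rw [e]
  refine (abs_add_le _ _).trans ?_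
  rw [abs_mul, abs_mul, abs_of_nonneg ha, abs_of_nonneg hb]
  calc _ ≤ a * (2 * M * |x - y|) + b * (2 * M * |x - y|) := by gcongr
    _ = _ := by rw [← add_mul, hab, one_mul]

theorem nK_nonempty {m M : ℝ} (h : m ≤ M) (hm : 0 < m) : (nK m M).Nonempty := by
  refine ⟨BoundedContinuousFunction.const _ m, fun t => ⟨le_rfl, h⟩, fun x y => ?_⟩
  have : 0 ≤ M := by linarith
  simp only [BoundedContinuousFunction.const_apply, sub_self, abs_zero]
  positivity

/-- A real continuous periodic function descends to the circle. -/
theorem exists_circle (g : ℝ → ℝ) (hc : Continuous g) (hp : Function.Periodic g (2 * Real.pi)) :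
    ∃ φ : BoundedContinuousFunction (AddCircle (2 * Real.pi)) ℝ,
      ∀ t : ℝ, φ (t : AddCircle (2 * Real.pi)) = g t := by
  have : Fact (0 < 2 * Real.pi) := ⟨by positivity⟩
  refine ⟨BoundedContinuousFunction.mkOfCompact ⟨hp.lift, ?_⟩, fun t => ?_⟩
  · exact continuous_coinduced_dom.2 hc
  · simp

/-- The forcing functional applied to a pair of circle functions. -/
noncomputable def nh (p q r : ℝ → ℝ) (k : ℝ)
    (φ ψ : BoundedContinuousFunction (AddCircle (2 * Real.pi)) ℝ) (t : ℝ) : ℝ :=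
  nH (p t) (q t) (r t) k (max (φ (t : AddCircle (2 * Real.pi))) 0)
    (max (ψ (t : AddCircle (2 * Real.pi))) 0) (max (φ ((t - 7 : ℝ) : AddCircle (2 * Real.pi))) 0)

theorem nh_cont {p q r : ℝ → ℝ} (hp : Continuous p) (hq : Continuous q) (hr : Continuous r) {k : ℝ}
    (hk : 2 ≤ k) (φ ψ : BoundedContinuousFunction (AddCircle (2 * Real.pi)) ℝ) :
    Continuous (nh p q r k φ ψ) := by
  have hmk : Continuous ((↑) : ℝ → AddCircle (2 * Real.pi)) := AddCircle.continuous_mk' _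
  have h1 : Continuous fun t : ℝ => max (φ (t : AddCircle (2 * Real.pi))) 0 :=
    (φ.continuous.comp hmk).max continuous_const
  have h2 : Continuous fun t : ℝ => max (ψ (t : AddCircle (2 * Real.pi))) 0 :=
    (ψ.continuous.comp hmk).max continuous_const
  have h3 : Continuous fun t : ℝ => max (φ ((t - 7 : ℝ) : AddCircle (2 * Real.pi))) 0 :=
    h1.comp (continuous_id.sub continuous_const)
  unfold nh nH
  refine (((continuous_const.mul h1).sub (hp.mul (h1.div (continuous_const.add h1) ?_))).add
    (hq.mul (h3.mul h3.neg.rexp))).add (hr.mul (h2.div (continuous_const.add h2) ?_))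
  · intro t
    have := le_max_right (φ (t : AddCircle (2 * Real.pi))) 0
    try simp only [Pi.add_apply]
    intro h0
    linarith
  · intro t
    have := le_max_right (ψ (t : AddCircle (2 * Real.pi))) 0
    try simp only [Pi.add_apply]
    intro h0
    linarith

theorem nh_periodic {p q r : ℝ → ℝ} (hp : Function.Periodic p (2 * Real.pi))
    (hq : Function.Periodic q (2 * Real.pi)) (hr : Function.Periodic r (2 * Real.pi)) (k : ℝ)
    (φ ψ : BoundedContinuousFunction (AddCircle (2 * Real.pi)) ℝ) :
    Function.Periodic (nh p q r k φ ψ) (2 * Real.pi) := by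
  intro t
  have e : t + 2 * Real.pi - 7 = (t - 7) + 2 * Real.pi := by ring
  simp only [nh, hp t, hq t, hr t, e, AddCircle.coe_add_period]

/-- One component of the solution operator maps the box into the right compact set. -/
theorem comp_props {p q r : ℝ → ℝ} {k M N m p0 p1 q0 q1 r0 r1 : ℝ}
    (pc : Continuous p) (qc : Continuous q) (rc : Continuous r)
    (pp : Function.Periodic p (2 * Real.pi))
    (qp : Function.Periodic q (2 * Real.pi)) (rp : Function.Periodic r (2 * Real.pi))
    (hm : m = Real.exp (-100)) (hk : 2 ≤ k) (hk' : k ≤ 3)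
    (hp : ∀ t, p0 ≤ p t ∧ p t ≤ p1) (hq : ∀ t, q1 ≤ q t ∧ q t ≤ q0)
    (hr : ∀ t, r1 ≤ r t ∧ r t ≤ r0) (hp0 : 0 ≤ p0) (hp1 : p1 ≤ 6) (hq1 : 0 ≤ q1) (hq0 : q0 ≤ 4)
    (hr1 : 0 ≤ r1) (hr0 : r0 ≤ 2.5) (hM : M ≤ 100)
    (hup : q0 * 0.368 + r0 * (N / (k + N)) ≤ p0 * (M / (4 + M)))
    (hlow : p1 / 4 ≤ q1 / 2 + r1 / (k + 0.01)) :
    ∃ T : BoundedContinuousFunction (AddCircle (2 * Real.pi)) ℝ →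
      BoundedContinuousFunction (AddCircle (2 * Real.pi)) ℝ →
      BoundedContinuousFunction (AddCircle (2 * Real.pi)) ℝ,
      (∀ φ ψ, ∀ t : ℝ, HasDerivAt (fun t : ℝ => T φ ψ (t : AddCircle (2 * Real.pi)))
        (-2 * T φ ψ (t : AddCircle (2 * Real.pi)) + nh p q r k φ ψ t) t) ∧
      (∀ φ ∈ nK m M, ∀ ψ ∈ nK m N, T φ ψ ∈ nK m M) ∧
      (∀ φ ψ φ' ψ', dist (T φ ψ) (T φ' ψ') ≤ 5 * max (dist φ φ') (dist ψ ψ')) := by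
  have hm0 : 0 < m := hm ▸ Real.exp_pos _
  have hc := nh_cont pc qc rc hk
  have hper := nh_periodic pp qp rp k
  have hcP : ∀ φ ψ, Continuous (nP (nh p q r k φ ψ)) := fun φ ψ =>
    continuous_iff_continuousAt.2 fun t => (nP_deriv (hc φ ψ) (hper φ ψ) t).continuousAt
  choose T hT using fun φ ψ => exists_circle (nP (nh p q r k φ ψ)) (hcP φ ψ) (nP_periodic (hper φ ψ))
  refine ⟨T, ?_, ?_, ?_⟩
  · intro φ ψ t
    have : (fun t : ℝ => T φ ψ (t : AddCircle (2 * Real.pi))) = nP (nh p q r k φ ψ) :=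
      funext fun t => hT φ ψ t
    rw [this, hT]
    exact nP_deriv (hc φ ψ) (hper φ ψ) t
  · intro φ hφ ψ hψ
    have hφ' : ∀ x, max (φ x) 0 = φ x := fun x => max_eq_left (hm0.le.trans (hφ.1 x).1)
    have hψ' : ∀ x, max (ψ x) 0 = ψ x := fun x => max_eq_left (hm0.le.trans (hψ.1 x).1)
    have hl : ∀ t, 2 * m ≤ nh p q r k φ ψ t := by
      intro t
      simp only [nh, hφ', hψ']
      exact nH_low hm (hp t).2 (hp0.trans ((hp t).1.trans (hp t).2)) (by linarith) (hq t).1 hq1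
        (hr t).1 hr1 hk hk' (hφ.1 _).1 (hψ.1 _).1 (hφ.1 _).1 ((hφ.1 _).2.trans hM) hlow
    have hu : ∀ t, nh p q r k φ ψ t ≤ 2 * M := by
      intro t
      simp only [nh, hφ', hψ']
      exact nH_up (hp t).1 hp0 (by linarith [(hp t).1, (hp t).2]) (hq1.trans (hq t).1) (hq t).2
        (hr1.trans (hr t).1) (hr t).2 hk (hm0.le.trans (hφ.1 _).1) (hφ.1 _).2
        (hm0.le.trans (hψ.1 _).1) (hψ.1 _).2 (hm0.le.trans (hφ.1 _).1) hup
    refine ⟨fun a => ?_, fun x y => ?_⟩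
    · induction a using QuotientAddGroup.induction_on with
      | H x =>
        have := hT φ ψ x
        change T φ ψ (x : AddCircle (2 * Real.pi)) ∈ _
        rw [this]
        exact ⟨nP_ge (hc φ ψ) hl x, nP_le (hc φ ψ) hu x⟩
    · rw [hT, hT]
      exact nP_lip (hc φ ψ) (hper φ ψ) hm0 hl hu x y
  · intro φ ψ φ' ψ'
    rw [BoundedContinuousFunction.dist_le (by positivity)]
    intro a
    induction a using QuotientAddGroup.induction_on with
    | H x =>
      change dist (T φ ψ (x : AddCircle (2 * Real.pi))) (T φ' ψ' (x : AddCircle (2 * Real.pi))) ≤ _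
      rw [hT, hT, Real.dist_eq]
      refine nP_dist (hc φ ψ) (hc φ' ψ') (fun t => ?_) x
      have d1 : ∀ z, |max (φ z) 0 - max (φ' z) 0| ≤ max (dist φ φ') (dist ψ ψ') := fun z =>
        (abs_max_sub_max_le_abs _ _ _).trans
          ((BoundedContinuousFunction.dist_coe_le_dist (f := φ) (g := φ') z).trans (le_max_left _ _))
      have d2 : ∀ z, |max (ψ z) 0 - max (ψ' z) 0| ≤ max (dist φ φ') (dist ψ ψ') := fun z =>
        (abs_max_sub_max_le_abs _ _ _).trans
          ((BoundedContinuousFunction.dist_coe_le_dist (f := ψ) (g := ψ') z).trans (le_max_right _ _))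
      exact nH_lip (hp0.trans (hp t).1) ((hp t).2.trans hp1) (hq1.trans (hq t).1)
        ((hq t).2.trans hq0) (hr1.trans (hr t).1) ((hr t).2.trans hr0) hk (le_max_right _ _)
        (le_max_right _ _) (le_max_right _ _) (le_max_right _ _) (le_max_right _ _)
        (le_max_right _ _) (d1 _) (d2 _) (d1 _)

/-- The example Nicholson-type system with α = 2, β = 3 and delay 7 admits
a positive 2π-periodic solution. -/
theorem example_system_periodic_solution :
    ∃ x₁ x₂ : ℝ → ℝ,
      Differentiable ℝ x₁ ∧ Differentiable ℝ x₂ ∧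
      Function.Periodic x₁ (2 * Real.pi) ∧ Function.Periodic x₂ (2 * Real.pi) ∧
      (∀ t, 0 < x₁ t) ∧ (∀ t, 0 < x₂ t) ∧
      (∀ t : ℝ, deriv x₁ t =
        -((5 + 0.25 * Real.sin t) * x₁ t / (4 + x₁ t))
          + 2 * (1 + 0.5 * Real.cos t) * (x₁ (t - 7) * Real.exp (-(x₁ (t - 7))))
          + (2 + 0.25 * Real.cos t) * x₂ t / (2 + x₂ t)) ∧
      (∀ t : ℝ, deriv x₂ t =
        -((4 + 0.5 * Real.cos t) * x₂ t / (4 + x₂ t))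
          + 3 * (1 + 0.25 * Real.cos t) * (x₂ (t - 7) * Real.exp (-(x₂ (t - 7))))
          + (2 + 0.5 * Real.sin t) * x₁ t / (3 + x₁ t)) := by
  obtain ⟨m, hm⟩ : ∃ m : ℝ, m = Real.exp (-100) := ⟨_, rfl⟩
  have hm0 : 0 < m := hm ▸ Real.exp_pos _
  have hm1 : m ≤ 1 := by rw [hm, Real.exp_le_one_iff]; norm_num
  have hs := Real.sin_le_one
  have hs' := Real.neg_one_le_sin
  have hc := Real.cos_le_one
  have hc' := Real.neg_one_le_cos
  obtain ⟨T₁, hd₁, hK₁, hL₁⟩ := comp_props (p := fun t => 5 + 0.25 * Real.sin t)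
    (q := fun t => 2 * (1 + 0.5 * Real.cos t)) (r := fun t => 2 + 0.25 * Real.cos t) (k := 2)
    (M := 10) (N := 100) (m := m) (p0 := 4.75) (p1 := 5.25) (q0 := 3) (q1 := 1) (r0 := 2.25)
    (r1 := 1.75) (by fun_prop) (by fun_prop) (by fun_prop)
    (fun t => by simp only [Real.sin_add_two_pi]) (fun t => by simp only [Real.cos_add_two_pi])
    (fun t => by simp only [Real.cos_add_two_pi]) hm (by norm_num) (by norm_num)
    (fun t => by constructor <;> linarith [hs t, hs' t])
    (fun t => by constructor <;> linarith [hc t, hc' t])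
    (fun t => by constructor <;> linarith [hc t, hc' t])
    (by norm_num) (by norm_num) (by norm_num) (by norm_num) (by norm_num) (by norm_num)
    (by norm_num) (by norm_num) (by norm_num)
  obtain ⟨T₂, hd₂, hK₂, hL₂⟩ := comp_props (p := fun t => 4 + 0.5 * Real.cos t)
    (q := fun t => 3 * (1 + 0.25 * Real.cos t)) (r := fun t => 2 + 0.5 * Real.sin t) (k := 3)
    (M := 100) (N := 10) (m := m) (p0 := 3.5) (p1 := 4.5) (q0 := 3.75) (q1 := 2.25) (r0 := 2.5)
    (r1 := 1.5) (by fun_prop) (by fun_prop) (by fun_prop)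
    (fun t => by simp only [Real.cos_add_two_pi]) (fun t => by simp only [Real.cos_add_two_pi])
    (fun t => by simp only [Real.sin_add_two_pi]) hm (by norm_num) (by norm_num)
    (fun t => by constructor <;> linarith [hc t, hc' t])
    (fun t => by constructor <;> linarith [hc t, hc' t])
    (fun t => by constructor <;> linarith [hs t, hs' t])
    (by norm_num) (by norm_num) (by norm_num) (by norm_num) (by norm_num) (by norm_num)
    (by norm_num) (by norm_num) (by norm_num)
  obtain ⟨⟨φ, ψ⟩, ⟨hφ, hψ⟩, hfix⟩ := schauder (nK m 10 ×ˢ nK m 100)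
    ((nK_compact _ _).prod (nK_compact _ _)) ((nK_convex _ _).prod (nK_convex _ _))
    ((nK_nonempty (by linarith) hm0).prod (nK_nonempty (by linarith) hm0))
    (fun x => (T₁ x.1 x.2, T₂ x.2 x.1))
    (by
      refine (LipschitzWith.of_dist_le_mul (K := 5) fun x y => ?_).continuous.continuousOn
      have h1 := hL₁ x.1 x.2 y.1 y.2
      have h2 := hL₂ x.2 x.1 y.2 y.1
      rw [max_comm] at h2
      rw [Prod.dist_eq, Prod.dist_eq]
      exact max_le h1 h2)
    (fun x hx => ⟨hK₁ _ hx.1 _ hx.2, hK₂ _ hx.2 _ hx.1⟩)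
  simp only [Prod.mk.injEq] at hfix
  obtain ⟨f1, f2⟩ := hfix
  have hφ' : ∀ x, max (φ x) 0 = φ x := fun x => max_eq_left (hm0.le.trans (hφ.1 x).1)
  have hψ' : ∀ x, max (ψ x) 0 = ψ x := fun x => max_eq_left (hm0.le.trans (hψ.1 x).1)
  have D1 := hd₁ φ ψ
  have D2 := hd₂ ψ φ
  simp only [f1, nh, hφ', hψ', nH] at D1
  simp only [f2, nh, hφ', hψ', nH] at D2
  refine ⟨fun t => φ (t : AddCircle (2 * Real.pi)), fun t => ψ (t : AddCircle (2 * Real.pi)),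
    fun t => (D1 t).differentiableAt, fun t => (D2 t).differentiableAt, fun t => ?_, fun t => ?_,
    fun t => hm0.trans_le (hφ.1 _).1, fun t => hm0.trans_le (hψ.1 _).1, fun t => ?_, fun t => ?_⟩
  · simp only [AddCircle.coe_add_period]
  · simp only [AddCircle.coe_add_period]
  · rw [(D1 t).deriv]; ring
  · rw [(D2 t).deriv]; ring
end
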